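/- The 3-dimensional Sklyanin algebra S = S(a,b,c) is a Noetherian (left and right) integral domain. -/

import Mathlib

noncomputable section

/-- The defining relations of the 3-dimensional Sklyanin algebra `S(a,b,c)`:
`a·yz + b·zy + c·x²`, `a·zx + b·xz + c·y²`, `a·xy + b·yx + c·z²` are set to zero.
The generators `x, y, z` are the images of `FreeAlgebra.ι k 0, 1, 2`. -/
inductive SklyaninRel (k : Type*) [CommRing k] (a b c : k) :
    FreeAlgebra k (Fin 3) → FreeAlgebra k (Fin 3) → Prop
  | r1 : SklyaninRel k a b c
      (a • (FreeAlgebra.ι k 1 * FreeAlgebra.ι k 2) + b • (FreeAlgebra.ι k 2 * FreeAlgebra.ι k 1)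
        + c • (FreeAlgebra.ι k 0 * FreeAlgebra.ι k 0)) 0
  | r2 : SklyaninRel k a b c
      (a • (FreeAlgebra.ι k 2 * FreeAlgebra.ι k 0) + b • (FreeAlgebra.ι k 0 * FreeAlgebra.ι k 2)
        + c • (FreeAlgebra.ι k 1 * FreeAlgebra.ι k 1)) 0
  | r3 : SklyaninRel k a b c
      (a • (FreeAlgebra.ι k 0 * FreeAlgebra.ι k 1) + b • (FreeAlgebra.ι k 1 * FreeAlgebra.ι k 0)
        + c • (FreeAlgebra.ι k 2 * FreeAlgebra.ι k 2)) 0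

/-- The 3-dimensional Sklyanin algebra `S(a,b,c)`: the quotient of the free algebra
`k⟨x,y,z⟩` by the two-sided ideal generated by the three Sklyanin relations. -/
def Sklyanin (k : Type*) [CommRing k] (a b c : k) : Type _ := RingQuot (SklyaninRel k a b c)

instance (k : Type*) [CommRing k] (a b c : k) : Ring (Sklyanin k a b c) := by
  unfold Sklyanin; infer_instance

instance (k : Type*) [CommRing k] (a b c : k) : Algebra k (Sklyanin k a b c) := by
  unfold Sklyanin; infer_instance

namespace Sklyanin

variable (k : Type*) [CommRing k] (a b c : k)

/-- The generator `x` of `S(a,b,c)`. -/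
def X : Sklyanin k a b c := RingQuot.mkAlgHom k (SklyaninRel k a b c) (FreeAlgebra.ι k 0)
/-- The generator `y` of `S(a,b,c)`. -/
def Y : Sklyanin k a b c := RingQuot.mkAlgHom k (SklyaninRel k a b c) (FreeAlgebra.ι k 1)
/-- The generator `z` of `S(a,b,c)`. -/
def Z : Sklyanin k a b c := RingQuot.mkAlgHom k (SklyaninRel k a b c) (FreeAlgebra.ι k 2)

/-- The canonical central element
`g = c(c³−b³)y³ + b(c³−a³)yxz + a(b³−c³)xyz + c(a³−c³)x³` of `S(a,b,c)`. -/
def g : Sklyanin k a b c :=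
  (c * (c ^ 3 - b ^ 3)) • (Y k a b c * Y k a b c * Y k a b c)
    + (b * (c ^ 3 - a ^ 3)) • (Y k a b c * X k a b c * Z k a b c)
    + (a * (b ^ 3 - c ^ 3)) • (X k a b c * Y k a b c * Z k a b c)
    + (c * (a ^ 3 - c ^ 3)) • (X k a b c * X k a b c * X k a b c)

end Sklyanin

section Noetherian

variable {k S : Type*} [Field k] [Ring S] [Algebra k S]

theorem finrank_map_add_finrank_inf_ker {M N : Type*} [AddCommGroup M] [Module k M]
    [AddCommGroup N] [Module k N] (f : M →ₗ[k] N) (B : Submodule k M) [FiniteDimensional k B] :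
    Module.finrank k (B.map f) + Module.finrank k (B ⊓ LinearMap.ker f : Submodule k M)
      = Module.finrank k B := by
  have h := (f.domRestrict B).finrank_range_add_finrank_ker
  rw [LinearMap.range_domRestrict] at h
  rw [← h]
  congr 1
  have e : (B ⊓ LinearMap.ker f : Submodule k M)
      = (LinearMap.ker (f.domRestrict B)).map B.subtype := by
    rw [LinearMap.domRestrict, LinearMap.ker_comp, Submodule.map_comap_subtype]
  rw [e]
  exact (Submodule.equivMapOfInjective B.subtype B.injective_subtype _).finrank_eq.symm

theorem finrank_map_mkQ_add {M : Type*} [AddCommGroup M] [Module k M] {A B : Submodule k M}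
    [FiniteDimensional k B] (h : A ≤ B) :
    Module.finrank k (B.map A.mkQ) + Module.finrank k A = Module.finrank k B := by
  have := finrank_map_add_finrank_inf_ker A.mkQ B
  rwa [Submodule.ker_mkQ, inf_eq_right.2 h] at this

theorem exists_stable_of_antitone (c : ℕ → ℕ → ℕ) (i₀ n₀ : ℕ)
    (h₁ : ∀ i ≥ i₀, ∀ n ≥ n₀, c (i + 1) n ≤ c i n)
    (h₂ : ∀ i ≥ i₀, ∀ n ≥ n₀, c i (n + 1) ≤ c i n) :
    ∃ N, i₀ ≤ N ∧ n₀ ≤ N ∧ ∀ i ≥ N, ∀ n ≥ N, c (i + 1) n = c i n ∧ c i (n + 1) = c i n := by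
  classical
  have hex : ∃ m, ∃ i ≥ i₀, ∃ n ≥ n₀, c i n = m := ⟨_, i₀, le_rfl, n₀, le_rfl, rfl⟩
  obtain ⟨i₁, hi₁, n₁, hn₁, h⟩ := Nat.find_spec hex
  have hmin : ∀ i ≥ i₀, ∀ n ≥ n₀, Nat.find hex ≤ c i n := fun i hi n hn =>
    Nat.find_min' hex ⟨i, hi, n, hn, rfl⟩
  have a₁ : ∀ i ≥ i₁, c i n₁ ≤ c i₁ n₁ := fun i hi => by
    induction i, hi using Nat.le_induction with
    | base => rfl
    | succ i hi ih => exact (h₁ i (hi₁.trans hi) n₁ hn₁).trans ih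
  have a₂ : ∀ i ≥ i₁, ∀ n ≥ n₁, c i n ≤ c i n₁ := fun i hi n hn => by
    induction n, hn using Nat.le_induction with
    | base => rfl
    | succ n hn ih => exact (h₂ i (hi₁.trans hi) n (hn₁.trans hn)).trans ih
  have key : ∀ i ≥ i₁, ∀ n ≥ n₁, c i n = Nat.find hex := fun i hi n hn =>
    le_antisymm (((a₂ i hi n hn).trans (a₁ i hi)).trans h.le)
      (hmin i (hi₁.trans hi) n (hn₁.trans hn))
  refine ⟨max i₁ n₁, by omega, by omega, fun i hi n hn => ⟨?_, ?_⟩⟩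
  · rw [key _ (by omega) _ (by omega), key _ (by omega) _ (by omega)]
  · rw [key _ (by omega) _ (by omega), key _ (by omega) _ (by omega)]

/-- The sequence of submodules `J n ≤ V ^ n` is small: modulo `J`, any left ideal generated by a
homogeneous element `f ∉ J` is, up to left multiples of a degree-one element, everything. -/
def IsCritical (V : Submodule k S) (J : ℕ → Submodule k S) : Prop :=
  ∀ m, ∀ f ∈ V ^ m, f ∉ J m → ∃ n₀ ≥ m, ∀ n ≥ n₀, ∃ u ∈ V,
    V ^ (n + 1) ≤ (V ^ n).map (LinearMap.mulLeft k u)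
      ⊔ (V ^ (n + 1 - m)).map (LinearMap.mulRight k f) ⊔ J (n + 1)

theorem IsCritical.exists_stable {V : Submodule k S} [FiniteDimensional k V]
    {J : ℕ → Submodule k S} (hJ : IsCritical V J) (K : ℕ → ℕ → Submodule k S)
    (hK : ∀ i n, K i n ≤ V ^ n) (hJK : ∀ i n, J n ≤ K i n) (hmono : ∀ i n, K i n ≤ K (i + 1) n)
    (hVK : ∀ i n, V * K i n ≤ K i (n + 1)) :
    ∃ N, ∀ i ≥ N, ∀ n ≥ N, K i (n + 1) ≤ V * K i n ⊔ J (n + 1) ∧ K (i + 1) n = K i n := by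
  classical
  have fd : ∀ n, FiniteDimensional k (V ^ n : Submodule k S) := fun n =>
    Module.Finite.iff_fg.2 ((Module.Finite.iff_fg.1 ‹_›).pow n)
  have fdK : ∀ i n, FiniteDimensional k (K i n) := fun i n =>
    Submodule.finiteDimensional_of_le (hK i n)
  by_cases hall : ∀ i n, K i n ≤ J n
  · refine ⟨0, fun i _ n _ => ⟨(hall i (n + 1)).trans le_sup_right, ?_⟩⟩
    rw [le_antisymm (hall i n) (hJK i n), le_antisymm (hall (i + 1) n) (hJK (i + 1) n)]
  push Not at hall
  obtain ⟨i₀, m, hm⟩ := hall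
  obtain ⟨f, hfK, hfJ⟩ := SetLike.not_le_iff_exists.1 hm
  obtain ⟨n₀, hn₀, hu⟩ := hJ m f (hK _ _ hfK) hfJ
  have hfK' : ∀ i ≥ i₀, f ∈ K i m := fun i hi => by
    induction i, hi using Nat.le_induction with
    | base => exact hfK
    | succ i hi ih => exact hmono i m ih
  have hpowK : ∀ i j n, V ^ j * K i n ≤ K i (n + j) := fun i j => by
    induction j with
    | zero => intro n; simp
    | succ j ih =>
      intro n
      rw [pow_succ, mul_assoc]
      refine (mul_le_mul' le_rfl (hVK i n)).trans ((ih (n + 1)).trans ?_)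
      rw [add_right_comm]; rfl
  have hSf : ∀ i ≥ i₀, ∀ n ≥ m,
      (V ^ (n + 1 - m)).map (LinearMap.mulRight k f) ≤ V * K i n := fun i hi n hn => by
    rw [Submodule.map_le_iff_le_comap]
    intro h hh
    have h1 : h * f ∈ V ^ (n + 1 - m) * K i m := Submodule.mul_mem_mul hh (hfK' i hi)
    rw [show n + 1 - m = (n - m) + 1 by omega, pow_succ', mul_assoc] at h1
    have := mul_le_mul' (le_refl V) (hpowK i (n - m) m) h1
    rwa [show m + (n - m) = n by omega] at this
  choose u huV hu using hu
  set c : ℕ → ℕ → ℕ := fun i n => Module.finrank k ((V ^ n).map (K i n).mkQ) with hc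
  have hcK : ∀ i n, c i n + Module.finrank k (K i n)
      = Module.finrank k (V ^ n : Submodule k S) := fun i n => finrank_map_mkQ_add (hK i n)
  have hstep : ∀ i ≥ i₀, ∀ n (hn : n ≥ n₀), c i (n + 1)
      + Module.finrank k (V ^ n ⊓ (K i (n + 1)).comap (LinearMap.mulLeft k (u n hn)) :
          Submodule k S) = Module.finrank k (V ^ n : Submodule k S) := fun i hi n hn => by
    have := finrank_map_add_finrank_inf_ker
      ((K i (n + 1)).mkQ ∘ₗ LinearMap.mulLeft k (u n hn)) (V ^ n)
    rw [LinearMap.ker_comp, Submodule.ker_mkQ, Submodule.map_comp] at this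
    rw [← this]
    congr 2
    have e : V ^ (n + 1) = (V ^ n).map (LinearMap.mulLeft k (u n hn)) ⊔ K i (n + 1) := by
      apply le_antisymm
      · refine (hu n hn).trans ?_
        rw [sup_assoc]
        refine sup_le_sup_left (sup_le ?_ (hJK _ _)) _
        exact (hSf i hi n (hn₀.trans hn)).trans (hVK _ _)
      · refine sup_le ?_ (hK _ _)
        rw [Submodule.map_le_iff_le_comap, pow_succ']
        exact fun h hh => Submodule.mul_mem_mul (huV n hn) hh
    change Module.finrank k ((V ^ (n + 1)).map (K i (n + 1)).mkQ) = _
    rw [e, Submodule.map_sup]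
    have : (K i (n + 1)).map (K i (n + 1)).mkQ = ⊥ := by simp
    rw [this, sup_bot_eq]
  have hle : ∀ i n (hn : n ≥ n₀),
      K i n ≤ V ^ n ⊓ (K i (n + 1)).comap (LinearMap.mulLeft k (u n hn)) := fun i n hn =>
    le_inf (hK i n) fun s hs => hVK i n (Submodule.mul_mem_mul (huV n hn) hs)
  obtain ⟨N, hN₁, hN₂, hN⟩ := exists_stable_of_antitone c i₀ n₀
    (fun i _ n _ => by
      have := Submodule.finrank_mono (hmono i n)
      have h1 := hcK i n
      have h2 := hcK (i + 1) n
      omega)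
    (fun i hi n hn => by
      have hfd : FiniteDimensional k (V ^ n ⊓ (K i (n + 1)).comap
        (LinearMap.mulLeft k (u n hn)) : Submodule k S) :=
        Submodule.finiteDimensional_of_le inf_le_left
      have := Submodule.finrank_mono (hle i n hn)
      have h1 := hcK i n
      have h2 := hstep i hi n hn
      omega)
  refine ⟨N, fun i hi n hn => ⟨?_, ?_⟩⟩
  · have hi' := hN₁.trans hi
    have hn' := hN₂.trans hn
    have hfd : FiniteDimensional k (V ^ n ⊓ (K i (n + 1)).comap
      (LinearMap.mulLeft k (u n hn')) : Submodule k S) :=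
      Submodule.finiteDimensional_of_le inf_le_left
    have heq := Submodule.eq_of_le_of_finrank_le (hle i n hn') (by
      have h1 := hcK i n
      have h2 := hstep i hi' n hn'
      have h3 := (hN i hi n hn).2
      omega)
    intro s hs
    obtain ⟨t, ht, j, hj, rfl⟩ := Submodule.mem_sup.1 (hu n hn' (hK _ _ hs))
    obtain ⟨p, hp, q, hq, rfl⟩ := Submodule.mem_sup.1 ht
    obtain ⟨s', hs', rfl⟩ := hp
    have hq' := hSf i hi' n (hn₀.trans hn') hq
    refine add_mem (add_mem (Submodule.mem_sup_left ?_) (Submodule.mem_sup_left hq'))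
      (Submodule.mem_sup_right hj)
    have : s' ∈ K i n := by
      rw [heq]
      refine ⟨hs', ?_⟩
      have h1 := sub_mem (sub_mem hs (hJK i (n + 1) hj)) (hVK _ _ hq')
      simpa using h1
    exact Submodule.mul_mem_mul (huV n hn') this
  · refine (Submodule.eq_of_le_of_finrank_le (hmono i n) ?_).symm
    have h1 := hcK i n
    have h2 := hcK (i + 1) n
    have h3 := (hN i hi n hn).1
    omega

theorem IsCritical.exists_generated {V : Submodule k S} [FiniteDimensional k V]
    {J : ℕ → Submodule k S} (hJ : IsCritical V J) (hJle : ∀ n, J n ≤ V ^ n)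
    (hVJ : ∀ n, V * J n ≤ J (n + 1)) {g : S} (hg : g ∈ V ^ 3) (hgc : ∀ s, g * s = s * g)
    (hJlow : ∀ n < 3, J n = ⊥) (hJg : ∀ n, J (n + 3) ≤ (V ^ n).map (LinearMap.mulLeft k g))
    (L : ℕ → Submodule k S) (hL : ∀ n, L n ≤ V ^ n) (hVL : ∀ n, V * L n ≤ L (n + 1)) :
    ∃ N, ∀ n ≥ N, L (n + 1) ≤ V * L n := by
  classical
  have fd : ∀ n, FiniteDimensional k (V ^ n : Submodule k S) := fun n =>
    Module.Finite.iff_fg.2 ((Module.Finite.iff_fg.1 ‹_›).pow n)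
  have hgci : ∀ i (s : S), g ^ i * s = s * g ^ i := fun i s =>
    ((show Commute g s from hgc s).pow_left i)
  set Q : ℕ → ℕ → Submodule k S := fun i n =>
    V ^ n ⊓ (L (n + 3 * i)).comap (LinearMap.mulLeft k (g ^ i)) with hQ
  have hQV : ∀ i n, V * Q i n ≤ (V * L (n + 3 * i)).comap (LinearMap.mulLeft k (g ^ i)) := by
    intro i n
    rw [Submodule.mul_le]
    intro v hv s hs
    rw [Submodule.mem_comap, LinearMap.mulLeft_apply, ← mul_assoc, hgci, mul_assoc]
    exact Submodule.mul_mem_mul hv hs.2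
  have hgL : ∀ n, ∀ s ∈ L n, g * s ∈ V * L (n + 2) := by
    intro n s hs
    have h1 : g * s ∈ V ^ 3 * L n := Submodule.mul_mem_mul hg hs
    have h2 : V ^ 3 * L n ≤ V * L (n + 2) := by
      rw [pow_succ', mul_assoc, pow_two, mul_assoc]
      exact mul_le_mul' le_rfl ((mul_le_mul' le_rfl (hVL n)).trans (hVL (n + 1)))
    exact h2 h1
  set K : ℕ → ℕ → Submodule k S := fun i n => J n ⊔ Q i n with hKdef
  have hK : ∀ i n, K i n ≤ V ^ n := fun i n => sup_le (hJle n) inf_le_left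
  have hJK : ∀ i n, J n ≤ K i n := fun i n => le_sup_left
  have hmono : ∀ i n, K i n ≤ K (i + 1) n := fun i n => by
    refine sup_le_sup_left (fun s hs => ⟨hs.1, ?_⟩) _
    rw [SetLike.mem_coe, Submodule.mem_comap, LinearMap.mulLeft_apply, pow_succ', mul_assoc]
    exact hVL _ (hgL _ _ hs.2)
  have hVK : ∀ i n, V * K i n ≤ K i (n + 1) := fun i n => by
    simp only [hKdef]
    rw [Submodule.mul_sup]
    refine sup_le_sup (hVJ n) (le_inf ?_ ?_)
    · rw [pow_succ']
      exact mul_le_mul' le_rfl inf_le_left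
    · refine (hQV i n).trans (Submodule.comap_mono ?_)
      rw [add_right_comm]
      exact hVL _
  obtain ⟨N₀, hN₀⟩ := hJ.exists_stable K hK hJK hmono hVK
  have hconst : ∀ i, ∃ N, ∀ n ≥ N, K i (n + 1) ≤ V * K i n ⊔ J (n + 1) := fun i => by
    obtain ⟨N, hN⟩ := hJ.exists_stable (fun _ => K i) (fun _ => hK i) (fun _ => hJK i)
      (fun _ _ => le_rfl) (fun _ => hVK i)
    exact ⟨N, fun n hn => (hN N le_rfl n hn).1⟩
  choose N₁ hN₁ using hconst
  obtain ⟨N, hN⟩ : ∃ N, ∀ i, ∀ n ≥ N, K i (n + 1) ≤ V * K i n ⊔ J (n + 1) := by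
    refine ⟨max N₀ ((Finset.range N₀).sup N₁), fun i n hn => ?_⟩
    by_cases hi : i < N₀
    · exact hN₁ i n (((Finset.le_sup (Finset.mem_range.2 hi)).trans (le_max_right _ _)).trans hn)
    · exact (hN₀ i (not_lt.1 hi) n ((le_max_left _ _).trans hn)).1
  have hstab : ∀ n, ∃ M, ∀ i ≥ M, K (i + 1) n = K i n := fun n => by
    have hfd : ∀ i, FiniteDimensional k (K i n) := fun i =>
      Submodule.finiteDimensional_of_le (hK i n)
    obtain ⟨M, -, -, hM⟩ := exists_stable_of_antitone (fun i _ =>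
      Module.finrank k (V ^ n : Submodule k S) - Module.finrank k (K i n)) 0 0
      (fun i _ _ _ => Nat.sub_le_sub_left (Submodule.finrank_mono (hmono i n)) _)
      (fun i _ _ _ => le_rfl)
    refine ⟨M, fun i hi => (Submodule.eq_of_le_of_finrank_le (hmono i n) ?_).symm⟩
    have h1 := (hM i hi M le_rfl).1
    have h2 := Submodule.finrank_mono (hK i n)
    have h3 := Submodule.finrank_mono (hK (i + 1) n)
    omega
  choose M₁ hM₁ using hstab
  obtain ⟨M, hM⟩ : ∃ M, ∀ n ≤ N, ∀ i ≥ M, K (i + 1) n = K i n :=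
    ⟨(Finset.range (N + 1)).sup M₁, fun n hn i hi => hM₁ n i
      ((Finset.le_sup (Finset.mem_range.2 (Nat.lt_succ_of_le hn))).trans hi)⟩
  have key : ∀ D ≥ N + 3 * M + 3, ∀ n i, n + 3 * i = D + 1 → ∀ s ∈ V ^ n,
      g ^ i * s ∈ L (D + 1) → g ^ i * s ∈ V * L D := by
    intro D hD n
    induction n using Nat.strong_induction_on with
    | _ n ih =>
      intro i hni s hs hsL
      have hsK : s ∈ K i n := Submodule.mem_sup_right
        ⟨hs, by rw [SetLike.mem_coe, Submodule.mem_comap, hni]; exact hsL⟩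
      obtain ⟨j, hj, q, hq, rfl⟩ : ∃ j ∈ J n, ∃ q, g ^ i * q ∈ V * L D ∧ j + q = s := by
        rcases Nat.lt_or_ge N n with hn | hn
        · obtain ⟨n', rfl⟩ : ∃ n', n = n' + 1 := ⟨n - 1, by omega⟩
          have h1 := hN i n' (by omega) hsK
          simp only [hKdef] at h1
          rw [Submodule.mul_sup] at h1
          have h2 : V * J n' ⊔ V * Q i n' ⊔ J (n' + 1) ≤ J (n' + 1) ⊔ V * Q i n' :=
            sup_le (sup_le ((hVJ n').trans le_sup_left) le_sup_right) le_sup_left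
          obtain ⟨j, hj, q, hq, e⟩ := Submodule.mem_sup.1 (h2 h1)
          refine ⟨j, hj, q, ?_, e⟩
          have h3 := hQV i n' hq
          rwa [Submodule.mem_comap, LinearMap.mulLeft_apply,
            show n' + 3 * i = D by omega] at h3
        · obtain ⟨i', rfl⟩ : ∃ i', i = i' + 1 := ⟨i - 1, by omega⟩
          rw [hM n hn i' (by omega)] at hsK
          obtain ⟨j, hj, q, hq, e⟩ := Submodule.mem_sup.1 hsK
          refine ⟨j, hj, q, ?_, e⟩
          have h3 := hgL _ _ hq.2
          rwa [LinearMap.mulLeft_apply, ← mul_assoc, ← pow_succ',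
            show n + 3 * i' + 2 = D by omega] at h3
      rw [mul_add] at hsL ⊢
      refine add_mem ?_ hq
      have hjL : g ^ i * j ∈ L (D + 1) := by
        have := sub_mem hsL (hVL D hq)
        rwa [add_sub_cancel_right] at this
      rcases Nat.lt_or_ge n 3 with hn | hn
      · rw [hJlow n hn, Submodule.mem_bot] at hj
        rw [hj, mul_zero]
        exact zero_mem _
      · obtain ⟨n', rfl⟩ : ∃ n', n = n' + 3 := ⟨n - 3, by omega⟩
        obtain ⟨t, ht, rfl⟩ := hJg n' hj
        rw [LinearMap.mulLeft_apply, ← mul_assoc, ← pow_succ] at hjL ⊢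
        exact ih n' (by omega) (i + 1) (by omega) t ht hjL
  refine ⟨N + 3 * M + 3, fun D hD s hs => ?_⟩
  have := key D hD (D + 1) 0 rfl s (hL _ hs)
  rw [pow_zero, one_mul] at this
  exact this hs

theorem IsCritical.isNoetherianRing {V : Submodule k S} [FiniteDimensional k V]
    {J : ℕ → Submodule k S} (hJ : IsCritical V J) (hJle : ∀ n, J n ≤ V ^ n)
    (hVJ : ∀ n, V * J n ≤ J (n + 1)) {g : S} (hg : g ∈ V ^ 3) (hgc : ∀ s, g * s = s * g)
    (hJlow : ∀ n < 3, J n = ⊥) (hJg : ∀ n, J (n + 3) ≤ (V ^ n).map (LinearMap.mulLeft k g))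
    (htop : ⨆ n, V ^ n = ⊤) : IsNoetherianRing S := by
  classical
  have fd : ∀ n, FiniteDimensional k (V ^ n : Submodule k S) := fun n =>
    Module.Finite.iff_fg.2 ((Module.Finite.iff_fg.1 ‹_›).pow n)
  rw [isNoetherianRing_iff_ideal_fg]
  intro I
  set I' : Submodule k S := I.restrictScalars k with hI'
  set F : ℕ → Submodule k S := fun n => (Finset.range n).sup (V ^ ·) with hF
  have hFfd : ∀ n, FiniteDimensional k (F n) := fun n => Submodule.finite_finset_sup _ _
  have hFs : ∀ n, F (n + 1) = V ^ n ⊔ F n := fun n => by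
    simp only [hF, Finset.range_add_one, Finset.sup_insert]
  have hFmono : Monotone F := monotone_nat_of_le_succ fun n => by
    rw [hFs]
    exact le_sup_right
  have hVF : ∀ n, V * F n ≤ F (n + 1) := fun n => by
    induction n with
    | zero => simp [hF]
    | succ n ih =>
      rw [hFs (n + 1), hFs n, Submodule.mul_sup, ← pow_succ']
      exact sup_le_sup le_rfl (ih.trans_eq (hFs n))
  have hFtop : ∀ s, ∃ n, s ∈ F n := fun s => by
    have h1 : (⊤ : Submodule k S) ≤ ⨆ n, F n := by
      rw [← htop]
      refine iSup_mono' fun n => ⟨n + 1, ?_⟩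
      rw [hFs]
      exact le_sup_left
    exact (Submodule.mem_iSup_of_directed _ hFmono.directed_le).1 (h1 trivial)
  have hVI : ∀ {W : Submodule k S}, V * (I' ⊓ W) ≤ I' := fun {W} =>
    Submodule.mul_le.2 fun v _ s hs => I.mul_mem_left v hs.1
  obtain ⟨N, hN⟩ := hJ.exists_generated hJle hVJ hg hgc hJlow hJg
    (fun n => V ^ n ⊓ (I' ⊔ F n)) (fun n => inf_le_left) (fun n => le_inf (by
      rw [pow_succ']
      exact mul_le_mul' le_rfl inf_le_left) (by
      refine (mul_le_mul' (le_refl V) inf_le_right).trans ?_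
      rw [Submodule.mul_sup]
      refine sup_le_sup ?_ (hVF n)
      simpa using hVI (W := ⊤)))
  have hLn : ∀ n, V * (V ^ n ⊓ (I' ⊔ F n)) ≤ V * (I' ⊓ F (n + 1)) ⊔ F (n + 1) := fun n => by
    refine le_trans (mul_le_mul' le_rfl ?_)
      ((Submodule.mul_sup V (I' ⊓ F (n + 1)) (F n)).le.trans (sup_le_sup le_rfl (hVF n)))
    rintro s ⟨hs, hs'⟩
    obtain ⟨i, hi, t, ht, rfl⟩ := Submodule.mem_sup.1 hs'
    refine add_mem (Submodule.mem_sup_left ⟨hi, ?_⟩) (Submodule.mem_sup_right ht)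
    rw [hFs, SetLike.mem_coe]
    have := sub_mem (Submodule.mem_sup_left (T := F n) hs) (Submodule.mem_sup_right ht)
    rwa [add_sub_cancel_right] at this
  obtain ⟨A, hA⟩ : (I' ⊓ F (N + 1)).FG := by
    have : FiniteDimensional k (I' ⊓ F (N + 1) : Submodule k S) :=
      Submodule.finiteDimensional_of_le inf_le_right
    exact Module.Finite.iff_fg.1 this
  have hAI : Ideal.span (A : Set S) ≤ I := Ideal.span_le.2 fun s hs =>
    (hA ▸ Submodule.subset_span hs : s ∈ I' ⊓ F (N + 1)).1
  have hbase : I' ⊓ F (N + 1) ≤ (Ideal.span (A : Set S)).restrictScalars k := by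
    rw [← hA, Submodule.span_le]
    exact fun s hs => Ideal.subset_span hs
  have hspan : V * (Ideal.span (A : Set S)).restrictScalars k
      ≤ (Ideal.span (A : Set S)).restrictScalars k :=
    Submodule.mul_le.2 fun v _ s hs => Ideal.mul_mem_left _ v hs
  have hall : ∀ n ≥ N + 1, I' ⊓ F n ≤ (Ideal.span (A : Set S)).restrictScalars k := by
    intro n hn
    induction n, hn using Nat.le_induction with
    | base => exact hbase
    | succ n hn ih =>
      obtain ⟨n, rfl⟩ : ∃ n', n = n' + 1 := ⟨n - 1, by omega⟩
      rintro s ⟨hsI, hsF⟩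
      rw [hFs] at hsF
      obtain ⟨p, hp, q, hq, rfl⟩ := Submodule.mem_sup.1 hsF
      have hpL : p ∈ V ^ (n + 1) ⊓ (I' ⊔ F (n + 1)) := by
        refine ⟨hp, ?_⟩
        have := sub_mem (Submodule.mem_sup_left (T := F (n + 1)) hsI)
          (Submodule.mem_sup_right hq)
        rwa [add_sub_cancel_right] at this
      obtain ⟨w, hw, t, ht, rfl⟩ := Submodule.mem_sup.1 (hLn n (hN n (by omega) hpL))
      have hw' : w ∈ (Ideal.span (A : Set S)).restrictScalars k :=
        hspan (mul_le_mul' le_rfl ih hw)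
      rw [add_assoc]
      refine add_mem hw' (ih ⟨?_, add_mem ht hq⟩)
      have := sub_mem hsI (hVI hw)
      rwa [add_assoc, add_sub_cancel_left] at this
  refine ⟨A, le_antisymm hAI fun s hs => ?_⟩
  obtain ⟨n, hn⟩ := hFtop s
  exact hall (max n (N + 1)) (le_max_right _ _) ⟨hs, hFmono (le_max_left _ _) hn⟩

end Noetherian

section Triple

variable {k B : Type*} [Field k] [Ring B] [Algebra k B]

/-- `x, y, z` satisfy the defining relations of `S(a,b,c)`. -/
structure SklyaninTriple (a b c : k) (x y z : B) : Prop where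
  r1 : a • (y * z) + b • (z * y) + c • (x * x) = 0
  r2 : a • (z * x) + b • (x * z) + c • (y * y) = 0
  r3 : a • (x * y) + b • (y * x) + c • (z * z) = 0

/-- The canonical cubic element, as an expression in `x, y, z`. -/
def sklyaninCubic (a b c : k) (x y z : B) : B :=
  (c * (c ^ 3 - b ^ 3)) • (y * y * y) + (b * (c ^ 3 - a ^ 3)) • (y * x * z)
    + (a * (b ^ 3 - c ^ 3)) • (x * y * z) + (c * (a ^ 3 - c ^ 3)) • (x * x * x)

namespace SklyaninTriple

variable {a b c : k} {x y z : B}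

theorem cubic_mul_x (h : SklyaninTriple a b c x y z) :
    sklyaninCubic a b c x y z * x = x * sklyaninCubic a b c x y z := by
  have key : sklyaninCubic a b c x y z * x - x * sklyaninCubic a b c x y z =
    (-b ^ 2 * c) • (y * y * (a • (x * y) + b • (y * x) + c • (z * z)))
    + (a * b * c) • (y * (a • (x * y) + b • (y * x) + c • (z * z)) * y)
    + (-b ^ 3) • (x * (a • (x * y) + b • (y * x) + c • (z * z)) * z)
    + (a ^ 2 * b) • ((a • (x * y) + b • (y * x) + c • (z * z)) * x * z)
    + (-a * b * c) • (z * (a • (z * x) + b • (x * z) + c • (y * y)) * z)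
    + (b ^ 2 * c) • ((a • (z * x) + b • (x * z) + c • (y * y)) * z * z)
    + (-a ^ 2 * b) • (y * x * (a • (z * x) + b • (x * z) + c • (y * y)))
    + (c ^ 3) • (y * (a • (z * x) + b • (x * z) + c • (y * y)) * x)
    + (b ^ 3 - c ^ 3) • (x * y * (a • (z * x) + b • (x * z) + c • (y * y)))
    + (-a * c ^ 2) • (y * z * (a • (y * z) + b • (z * y) + c • (x * x)))
    + (a * c ^ 2) • ((a • (y * z) + b • (z * y) + c • (x * x)) * y * z) := by
    simp only [sklyaninCubic, mul_add, add_mul, smul_mul_assoc, mul_smul_comm, mul_assoc, smul_add]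
    module
  rw [← sub_eq_zero, key]
  simp only [h.r1, h.r2, h.r3, mul_zero, zero_mul, smul_zero, add_zero]

theorem cubic_mul_y (h : SklyaninTriple a b c x y z) :
    sklyaninCubic a b c x y z * y = y * sklyaninCubic a b c x y z := by
  have key : sklyaninCubic a b c x y z * y - y * sklyaninCubic a b c x y z =
    (a ^ 3) • (y * (a • (x * y) + b • (y * x) + c • (z * z)) * z)
    + (-a * b ^ 2) • ((a • (x * y) + b • (y * x) + c • (z * z)) * y * z)
    + (a ^ 2 * c) • (x * x * (a • (x * y) + b • (y * x) + c • (z * z)))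
    + (-a * b * c) • (x * (a • (x * y) + b • (y * x) + c • (z * z)) * x)
    + (b * c ^ 2) • (x * z * (a • (z * x) + b • (x * z) + c • (y * y)))
    + (-b * c ^ 2) • ((a • (z * x) + b • (x * z) + c • (y * y)) * x * z)
    + (a * b * c) • (z * (a • (y * z) + b • (z * y) + c • (x * x)) * z)
    + (-a ^ 2 * c) • ((a • (y * z) + b • (z * y) + c • (x * x)) * z * z)
    + (-a ^ 3 + c ^ 3) • (y * x * (a • (y * z) + b • (z * y) + c • (x * x)))
    + (a * b ^ 2) • (x * y * (a • (y * z) + b • (z * y) + c • (x * x)))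
    + (-c ^ 3) • (x * (a • (y * z) + b • (z * y) + c • (x * x)) * y) := by
    simp only [sklyaninCubic, mul_add, add_mul, smul_mul_assoc, mul_smul_comm, mul_assoc, smul_add]
    module
  rw [← sub_eq_zero, key]
  simp only [h.r1, h.r2, h.r3, mul_zero, zero_mul, smul_zero, add_zero]

theorem cubic_mul_z (h : SklyaninTriple a b c x y z) :
    sklyaninCubic a b c x y z * z = z * sklyaninCubic a b c x y z := by
  have key : sklyaninCubic a b c x y z * z - z * sklyaninCubic a b c x y z =
    (-a * c ^ 2) • (x * y * (a • (x * y) + b • (y * x) + c • (z * z)))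
    + (a * c ^ 2) • ((a • (x * y) + b • (y * x) + c • (z * z)) * x * y)
    + (-c ^ 3) • (z * (a • (z * x) + b • (x * z) + c • (y * y)) * y)
    + (-a ^ 3 + c ^ 3) • (y * (a • (z * x) + b • (x * z) + c • (y * y)) * z)
    + (-b ^ 3) • ((a • (z * x) + b • (x * z) + c • (y * y)) * y * z)
    + (-b ^ 2 * c) • (x * x * (a • (z * x) + b • (x * z) + c • (y * y)))
    + (a * b * c) • (x * (a • (z * x) + b • (x * z) + c • (y * y)) * x)
    + (-a ^ 2 * c) • ((a • (z * x) + b • (x * z) + c • (y * y)) * x * x)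
    + (c ^ 3) • (z * x * (a • (y * z) + b • (z * y) + c • (x * x)))
    + (a ^ 2 * c) • (y * y * (a • (y * z) + b • (z * y) + c • (x * x)))
    + (-a * b * c) • (y * (a • (y * z) + b • (z * y) + c • (x * x)) * y)
    + (b ^ 2 * c) • ((a • (y * z) + b • (z * y) + c • (x * x)) * y * y)
    + (b ^ 3) • (x * (a • (y * z) + b • (z * y) + c • (x * x)) * z)
    + (a ^ 3 - c ^ 3) • ((a • (y * z) + b • (z * y) + c • (x * x)) * x * z) := by
    simp only [sklyaninCubic, mul_add, add_mul, smul_mul_assoc, mul_smul_comm, mul_assoc, smul_add]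
    module
  rw [← sub_eq_zero, key]
  simp only [h.r1, h.r2, h.r3, mul_zero, zero_mul, smul_zero, add_zero]

theorem base_xy (h : SklyaninTriple a b c x y z) :
    (b * (a ^ 3 - c ^ 3)) • ((b • (y * y) + a • (y * z) - a • (z * z)) * x) -
        (c * (b ^ 3 - a ^ 3)) • ((b • (y * y) + a • (y * z) - a • (z * z)) * y) =
      x * ((-a ^ 2 * b ^ 3) • (z * z) + (b ^ 3 * c ^ 2) • (z * x) +
          (-a * b ^ 4 + a * b * c ^ 3) • (y * z) + (a ^ 5) • (y * y) + (-a ^ 2 * b * c ^ 2) • (y * x) +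
          (a ^ 2 * b * c ^ 2) • (x * z) + (-a ^ 3 * c ^ 2) • (x * y) +
          (-a ^ 3 * b * c + b * c ^ 4) • (x * x))
      + (b) • sklyaninCubic a b c x y z := by
  have key : (b * (a ^ 3 - c ^ 3)) • ((b • (y * y) + a • (y * z) - a • (z * z)) * x) -
      (c * (b ^ 3 - a ^ 3)) • ((b • (y * y) + a • (y * z) - a • (z * z)) * y) =
      x * ((-a ^ 2 * b ^ 3) • (z * z) + (b ^ 3 * c ^ 2) • (z * x) +
          (-a * b ^ 4 + a * b * c ^ 3) • (y * z) + (a ^ 5) • (y * y) + (-a ^ 2 * b * c ^ 2) • (y * x) +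
          (a ^ 2 * b * c ^ 2) • (x * z) + (-a ^ 3 * c ^ 2) • (x * y) +
          (-a ^ 3 * b * c + b * c ^ 4) • (x * x))
      + (b) • sklyaninCubic a b c x y z + (
    (-a ^ 4) • ((a • (x * y) + b • (y * x) + c • (z * z)) * y)
    + (a ^ 3 * b) • (y * (a • (x * y) + b • (y * x) + c • (z * z)))
    + (a * b * c ^ 2) • ((a • (x * y) + b • (y * x) + c • (z * z)) * x)
    + (a ^ 2 * b ^ 2) • ((a • (z * x) + b • (x * z) + c • (y * y)) * z)
    + (-a ^ 3 * b) • (z * (a • (z * x) + b • (x * z) + c • (y * y)))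
    + (a ^ 3 * b - b * c ^ 3) • (y * (a • (z * x) + b • (x * z) + c • (y * y)))
    + (-b ^ 2 * c ^ 2) • ((a • (z * x) + b • (x * z) + c • (y * y)) * x)
    + (-a ^ 2 * b * c) • ((a • (y * z) + b • (z * y) + c • (x * x)) * z)
    + (a * b ^ 2 * c) • (z * (a • (y * z) + b • (z * y) + c • (x * x)))
    + (a ^ 3 * c) • ((a • (y * z) + b • (z * y) + c • (x * x)) * y)
    + (-a * b ^ 2 * c) • (y * (a • (y * z) + b • (z * y) + c • (x * x)))) := by
    simp only [sklyaninCubic, mul_add, add_mul, mul_sub, sub_mul, smul_mul_assoc, mul_smul_comm,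
        mul_assoc, smul_add, smul_sub]
    module
  rw [key]
  simp only [h.r1, h.r2, h.r3, mul_zero, zero_mul, smul_zero, add_zero]

theorem base_xz (h : SklyaninTriple a b c x y z) :
    (a * (c ^ 3 - b ^ 3)) • ((b • (y * y) + a • (y * z) - a • (z * z)) * x) -
        (c * (b ^ 3 - a ^ 3)) • ((b • (y * y) + a • (y * z) - a • (z * z)) * z) =
      x * ((b ^ 5) • (z * z) + (-a * b ^ 2 * c ^ 2) • (z * x) + (a ^ 5 - a ^ 2 * c ^ 3) • (y * z) +
          (-a ^ 3 * b ^ 2) • (y * y) + (a ^ 3 * c ^ 2) • (y * x) + (-a ^ 3 * c ^ 2) • (x * z) +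
          (a * b ^ 2 * c ^ 2) • (x * y) + (a ^ 4 * c - a * c ^ 4) • (x * x))
      + (-a) • sklyaninCubic a b c x y z := by
  have key : (a * (c ^ 3 - b ^ 3)) • ((b • (y * y) + a • (y * z) - a • (z * z)) * x) -
      (c * (b ^ 3 - a ^ 3)) • ((b • (y * y) + a • (y * z) - a • (z * z)) * z) =
      x * ((b ^ 5) • (z * z) + (-a * b ^ 2 * c ^ 2) • (z * x) + (a ^ 5 - a ^ 2 * c ^ 3) • (y * z) +
          (-a ^ 3 * b ^ 2) • (y * y) + (a ^ 3 * c ^ 2) • (y * x) + (-a ^ 3 * c ^ 2) • (x * z) +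
          (a * b ^ 2 * c ^ 2) • (x * y) + (a ^ 4 * c - a * c ^ 4) • (x * x))
      + (-a) • sklyaninCubic a b c x y z + (
    (-a ^ 4 + a * b ^ 3) • ((a • (x * y) + b • (y * x) + c • (z * z)) * z)
    + (a ^ 2 * b ^ 2) • ((a • (x * y) + b • (y * x) + c • (z * z)) * y)
    + (-a * b ^ 3) • (y * (a • (x * y) + b • (y * x) + c • (z * z)))
    + (-a ^ 2 * c ^ 2) • ((a • (x * y) + b • (y * x) + c • (z * z)) * x)
    + (-b ^ 4) • ((a • (z * x) + b • (x * z) + c • (y * y)) * z)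
    + (a * b ^ 3) • (z * (a • (z * x) + b • (x * z) + c • (y * y)))
    + (-a * b ^ 3 + a * c ^ 3) • (y * (a • (z * x) + b • (x * z) + c • (y * y)))
    + (a * b * c ^ 2) • ((a • (z * x) + b • (x * z) + c • (y * y)) * x)
    + (a ^ 3 * c) • ((a • (y * z) + b • (z * y) + c • (x * x)) * z)
    + (-a ^ 2 * b * c) • (z * (a • (y * z) + b • (z * y) + c • (x * x)))
    + (-a * b ^ 2 * c) • ((a • (y * z) + b • (z * y) + c • (x * x)) * y)
    + (a ^ 2 * b * c) • (y * (a • (y * z) + b • (z * y) + c • (x * x)))) := by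
    simp only [sklyaninCubic, mul_add, add_mul, mul_sub, sub_mul, smul_mul_assoc, mul_smul_comm,
        mul_assoc, smul_add, smul_sub]
    module
  rw [key]
  simp only [h.r1, h.r2, h.r3, mul_zero, zero_mul, smul_zero, add_zero]

theorem base_yz (h : SklyaninTriple a b c x y z) :
    c • ((a * (c ^ 3 - b ^ 3)) • ((b • (y * y) + a • (y * z) - a • (z * z)) * y) -
        (b * (a ^ 3 - c ^ 3)) • ((b • (y * y) + a • (y * z) - a • (z * z)) * z)) =
      x * ((-b ^ 3 * c ^ 3) • (z * z) + (a * b ^ 3 * c ^ 2) • (z * x) +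
          (-a ^ 5 * b - a ^ 2 * b ^ 4 + 2 * a ^ 2 * b * c ^ 3) • (y * z) +
          (a ^ 3 * c ^ 3) • (y * y) + (-a ^ 3 * b * c ^ 2) • (y * x) +
          (a ^ 3 * b * c ^ 2) • (x * z) + (-a * c ^ 5) • (x * y) +
          (-a ^ 4 * b * c + a * b * c ^ 4) • (x * x))
      + (a * b) • sklyaninCubic a b c x y z := by
  have key : c • ((a * (c ^ 3 - b ^ 3)) • ((b • (y * y) + a • (y * z) - a • (z * z)) * y) -
      (b * (a ^ 3 - c ^ 3)) • ((b • (y * y) + a • (y * z) - a • (z * z)) * z)) =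
      x * ((-b ^ 3 * c ^ 3) • (z * z) + (a * b ^ 3 * c ^ 2) • (z * x) +
          (-a ^ 5 * b - a ^ 2 * b ^ 4 + 2 * a ^ 2 * b * c ^ 3) • (y * z) +
          (a ^ 3 * c ^ 3) • (y * y) + (-a ^ 3 * b * c ^ 2) • (y * x) +
          (a ^ 3 * b * c ^ 2) • (x * z) + (-a * c ^ 5) • (x * y) +
          (-a ^ 4 * b * c + a * b * c ^ 4) • (x * x))
      + (a * b) • sklyaninCubic a b c x y z + (
    (a ^ 4 * b - a * b * c ^ 3) • ((a • (x * y) + b • (y * x) + c • (z * z)) * z)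
    + (-a ^ 2 * c ^ 3) • ((a • (x * y) + b • (y * x) + c • (z * z)) * y)
    + (a * b * c ^ 3) • (y * (a • (x * y) + b • (y * x) + c • (z * z)))
    + (a ^ 2 * b * c ^ 2) • ((a • (x * y) + b • (y * x) + c • (z * z)) * x)
    + (b ^ 2 * c ^ 3) • ((a • (z * x) + b • (x * z) + c • (y * y)) * z)
    + (-a * b * c ^ 3) • (z * (a • (z * x) + b • (x * z) + c • (y * y)))
    + (-a * b ^ 2 * c ^ 2) • ((a • (z * x) + b • (x * z) + c • (y * y)) * x)
    + (-a ^ 3 * b * c) • ((a • (y * z) + b • (z * y) + c • (x * x)) * z)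
    + (a ^ 2 * b ^ 2 * c) • (z * (a • (y * z) + b • (z * y) + c • (x * x)))
    + (a * c ^ 4) • ((a • (y * z) + b • (z * y) + c • (x * x)) * y)
    + (-a ^ 2 * b ^ 2 * c) • (y * (a • (y * z) + b • (z * y) + c • (x * x)))) := by
    simp only [sklyaninCubic, mul_add, add_mul, mul_sub, sub_mul, smul_mul_assoc, mul_smul_comm,
        mul_assoc, smul_add, smul_sub]
    module
  rw [key]
  simp only [h.r1, h.r2, h.r3, mul_zero, zero_mul, smul_zero, add_zero]

end SklyaninTriple

end Triple

universe u

section Universal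

open MulOpposite

variable {k : Type u} [Field k] {S : Type u} [Ring S] [Algebra k S]

/-- `S`, with generators `v 0, v 1, v 2`, has the presentation of `S(a,b,c)`. -/
structure IsSklyanin (a b c : k) (v : Fin 3 → S) : Prop where
  triple : SklyaninTriple a b c (v 0) (v 1) (v 2)
  adjoin : Algebra.adjoin k (Set.range v) = ⊤
  lift : ∀ {B : Type u} [Ring B] [Algebra k B] (w : Fin 3 → B),
    SklyaninTriple a b c (w 0) (w 1) (w 2) → ∃ φ : S →ₐ[k] B, ∀ i, φ (v i) = w i

theorem SklyaninTriple.opposite {a b c : k} {x y z : S} (h : SklyaninTriple a b c x y z) :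
    SklyaninTriple b a c (op x) (op y) (op z) := by
  refine ⟨?_, ?_, ?_⟩
  · rw [← op_zero, ← h.r1]; simp only [op_add, op_smul, op_mul]; abel
  · rw [← op_zero, ← h.r2]; simp only [op_add, op_smul, op_mul]; abel
  · rw [← op_zero, ← h.r3]; simp only [op_add, op_smul, op_mul]; abel

theorem adjoin_range_op {v : Fin 3 → S} (h : Algebra.adjoin k (Set.range v) = ⊤) :
    Algebra.adjoin k (Set.range fun i => op (v i)) = ⊤ := by
  rw [eq_top_iff]
  intro s _
  have hs : unop s ∈ Algebra.adjoin k (Set.range v) := h ▸ Algebra.mem_top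
  rw [← op_unop s]
  generalize unop s = s at hs
  induction hs using Algebra.adjoin_induction with
  | mem x hx =>
    obtain ⟨i, rfl⟩ := hx
    exact Algebra.subset_adjoin ⟨i, rfl⟩
  | algebraMap r => exact Subalgebra.algebraMap_mem _ r
  | add x y _ _ hx hy => exact add_mem hx hy
  | mul x y _ _ hx hy => exact mul_mem hy hx

theorem IsSklyanin.opposite {a b c : k} {v : Fin 3 → S} (h : IsSklyanin a b c v) :
    IsSklyanin b a c (fun i => op (v i)) where
  triple := h.triple.opposite
  adjoin := adjoin_range_op h.adjoin
  lift {B} _ _ w hw := by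
    obtain ⟨φ, hφ⟩ := h.lift (fun i => op (w i)) hw.opposite
    refine ⟨AlgHom.opComm φ, fun i => ?_⟩
    simp [AlgHom.opComm, hφ]

variable {v : Fin 3 → S}

/-- The span of the generators. -/
abbrev genSpan (k : Type u) [Field k] {S : Type u} [Ring S] [Algebra k S] (v : Fin 3 → S) :
    Submodule k S := Submodule.span k (Set.range v)

instance : FiniteDimensional k (genSpan k v) :=
  FiniteDimensional.span_of_finite k (Set.finite_range _)

theorem gen_mem (v : Fin 3 → S) (i : Fin 3) : v i ∈ genSpan k v := Submodule.subset_span ⟨i, rfl⟩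

theorem iSup_genSpan_pow (h : Algebra.adjoin k (Set.range v) = ⊤) :
    ⨆ n, genSpan k v ^ n = ⊤ := by
  rw [eq_top_iff]
  intro s _
  have hs : s ∈ Algebra.adjoin k (Set.range v) := h ▸ Algebra.mem_top
  induction hs using Algebra.adjoin_induction with
  | mem x hx =>
    exact Submodule.mem_iSup_of_mem 1 (by rw [pow_one]; exact Submodule.subset_span hx)
  | algebraMap r =>
    refine Submodule.mem_iSup_of_mem 0 ?_
    rw [pow_zero]
    exact Submodule.algebraMap_mem r
  | add x y _ _ hx hy => exact add_mem (hx trivial) (hy trivial)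
  | mul x y _ _ hx hy =>
    have hle : (⨆ n, genSpan k v ^ n) * (⨆ n, genSpan k v ^ n) ≤ ⨆ n, genSpan k v ^ n := by
      rw [Submodule.iSup_mul]
      refine iSup_le fun i => ?_
      rw [Submodule.mul_iSup]
      refine iSup_le fun j => ?_
      rw [← pow_add]
      exact le_iSup (fun n => genSpan k v ^ n) (i + j)
    exact hle (Submodule.mul_mem_mul (hx trivial) (hy trivial))

section Grading

open Polynomial

theorem SklyaninTriple.mulX {a b c : k} {x y z : S} (h : SklyaninTriple a b c x y z) :
    SklyaninTriple a b c (C x * (X : S[X])) (C y * X) (C z * X) := by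
  have e : ∀ p q : S, C p * (X : S[X]) * (C q * X) = C (p * q) * X ^ 2 := by
    intro p q
    rw [mul_assoc, ← mul_assoc X, X_mul_C, mul_assoc, ← pow_two, ← mul_assoc, C_mul]
  have e' : ∀ (r : k) (p : S), r • (C p * (X : S[X]) ^ 2) = C (r • p) * X ^ 2 := by
    intro r p
    rw [← smul_C, smul_mul_assoc]
  refine ⟨?_, ?_, ?_⟩
  · simp only [e, e', ← add_mul, ← C_add, h.r1, C_0, zero_mul]
  · simp only [e, e', ← add_mul, ← C_add, h.r2, C_0, zero_mul]
  · simp only [e, e', ← add_mul, ← C_add, h.r3, C_0, zero_mul]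

/-- The coaction encoding a grading for which the `v i` are homogeneous of degree one. -/
def IsGrading (v : Fin 3 → S) (δ : S →ₐ[k] S[X]) : Prop := ∀ i, δ (v i) = C (v i) * X

theorem IsSklyanin.exists_grading {a b c : k} (h : IsSklyanin a b c v) :
    ∃ δ : S →ₐ[k] S[X], IsGrading v δ :=
  h.lift (fun i => C (v i) * X) h.triple.mulX

variable {δ : S →ₐ[k] S[X]}

theorem IsGrading.apply_eq (hδ : IsGrading v δ) {n : ℕ} :
    ∀ {s : S}, s ∈ genSpan k v ^ n → δ s = C s * X ^ n := by
  induction n with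
  | zero =>
    intro s hs
    rw [pow_zero, Submodule.mem_one] at hs
    obtain ⟨r, rfl⟩ := hs
    simp only [AlgHom.commutes, pow_zero, mul_one]
    rfl
  | succ n ih =>
    intro s hs
    rw [pow_succ] at hs
    induction hs using Submodule.mul_induction_on' with
    | mem_mul_mem p hp q hq =>
      have hq' : δ q = C q * X := by
        induction hq using Submodule.span_induction with
        | mem x hx => obtain ⟨i, rfl⟩ := hx; exact hδ i
        | zero => simp
        | add x y _ _ hx hy => rw [map_add, hx, hy, C_add, add_mul]
        | smul r x _ hx => rw [map_smul, hx, ← smul_C, smul_mul_assoc]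
      rw [map_mul, ih hp, hq', mul_assoc, ← mul_assoc (X ^ n), X_pow_mul_C, mul_assoc, ← pow_succ,
        ← mul_assoc, C_mul]
    | add x _ y _ hx hy => rw [map_add, hx, hy, C_add, add_mul]

theorem IsGrading.coeff_of_mem (hδ : IsGrading v δ) {n : ℕ} {s : S} (hs : s ∈ genSpan k v ^ n)
    (m : ℕ) : (δ s).coeff m = if m = n then s else 0 := by
  rw [hδ.apply_eq hs, coeff_C_mul_X_pow]

theorem IsGrading.coeff_mem (hδ : IsGrading v δ) (h : Algebra.adjoin k (Set.range v) = ⊤)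
    (n : ℕ) (s : S) : (δ s).coeff n ∈ genSpan k v ^ n := by
  have hs : s ∈ ⨆ n, genSpan k v ^ n := iSup_genSpan_pow h ▸ Submodule.mem_top
  induction hs using Submodule.iSup_induction' with
  | mem i x hx =>
    rw [hδ.coeff_of_mem hx]
    split_ifs with hi
    · exact hi ▸ hx
    · exact zero_mem _
  | zero => simp
  | add x y _ _ hx hy => rw [map_add, coeff_add]; exact add_mem hx hy

theorem IsGrading.coeff_mul_gen (hδ : IsGrading v δ) (s : S) (i : Fin 3) (n : ℕ) :
    (δ (s * v i)).coeff (n + 1) = (δ s).coeff n * v i := by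
  rw [map_mul, hδ i, ← mul_assoc, coeff_mul_X, coeff_mul_C]

theorem IsGrading.eval_one (hδ : IsGrading v δ) (h : Algebra.adjoin k (Set.range v) = ⊤) (s : S) :
    (δ s).eval 1 = s := by
  have hs : s ∈ ⨆ n, genSpan k v ^ n := iSup_genSpan_pow h ▸ Submodule.mem_top
  induction hs using Submodule.iSup_induction' with
  | mem i x hx => rw [hδ.apply_eq hx, C_mul_X_pow_eq_monomial, eval_monomial, one_pow, mul_one]
  | zero => simp
  | add x y _ _ hx hy => rw [map_add, eval_add, hx, hy]

theorem IsGrading.noZeroDivisors (hδ : IsGrading v δ) (h : Algebra.adjoin k (Set.range v) = ⊤)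
    (hom : ∀ m n : ℕ, ∀ s ∈ genSpan k v ^ m, ∀ t ∈ genSpan k v ^ n, s * t = 0 → s = 0 ∨ t = 0) :
    NoZeroDivisors S where
  eq_zero_or_eq_zero_of_mul_eq_zero {s t} hst := by
    have hp : ∀ s : S, (δ s).leadingCoeff = 0 → s = 0 := by
      intro s hs
      rw [← hδ.eval_one h s, leadingCoeff_eq_zero.1 hs, eval_zero]
    have h0 : (δ s).leadingCoeff * (δ t).leadingCoeff = 0 := by
      rw [← coeff_mul_degree_add_degree, ← map_mul, hst, map_zero, coeff_zero]
    exact (hom _ _ _ (hδ.coeff_mem h _ s) _ (hδ.coeff_mem h _ t) h0).imp (hp s) (hp t)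

end Grading

section Koszul

/-- The three rows of left coefficients of the relations. -/
def relRow (a b c : k) (v : Fin 3 → S) : Fin 3 → Fin 3 → S :=
  ![![c • v 0, b • v 2, a • v 1], ![a • v 2, c • v 1, b • v 0], ![b • v 1, a • v 0, c • v 2]]

/-- Evaluation of a row of left coefficients at the generators. -/
def rowEval (v : Fin 3 → S) : (Fin 3 → S) →ₗ[S] S := Fintype.linearCombination S v

theorem rowEval_apply (v : Fin 3 → S) (α : Fin 3 → S) :
    rowEval v α = α 0 * v 0 + α 1 * v 1 + α 2 * v 2 := by
  simp [rowEval, Fintype.linearCombination_apply, Fin.sum_univ_three]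

variable {a b c : k}

theorem SklyaninTriple.rowEval_relRow (h : SklyaninTriple a b c (v 0) (v 1) (v 2)) (i : Fin 3) :
    rowEval v (relRow a b c v i) = 0 := by
  rw [rowEval_apply]
  fin_cases i
  · simp only [relRow, Fin.zero_eta, Matrix.cons_val, smul_mul_assoc]
    rw [← h.r1]; abel
  · simp only [relRow, Fin.mk_one, Matrix.cons_val, smul_mul_assoc]
    rw [← h.r2]; abel
  · simp only [relRow, Fin.reduceFinMk, Matrix.cons_val, smul_mul_assoc]
    rw [← h.r3]; abel

theorem SklyaninTriple.left_syzygy (h : SklyaninTriple a b c (v 0) (v 1) (v 2)) (j : Fin 3) :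
    v 0 * relRow a b c v 0 j + v 1 * relRow a b c v 1 j + v 2 * relRow a b c v 2 j = 0 := by
  fin_cases j
  · simp only [relRow, Fin.zero_eta, Matrix.cons_val, mul_smul_comm]
    rw [← h.r1]; abel
  · simp only [relRow, Fin.mk_one, Matrix.cons_val, mul_smul_comm]
    rw [← h.r2]; abel
  · simp only [relRow, Fin.reduceFinMk, Matrix.cons_val, mul_smul_comm]
    rw [← h.r3]

theorem IsSklyanin.mem_span_relRow (h : IsSklyanin a b c v) {α : Fin 3 → S}
    (hα : rowEval v α = 0) : α ∈ Submodule.span S (Set.range (relRow a b c v)) := by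
  set K := Submodule.span S (Set.range (relRow a b c v)) with hK
  have hKψ : K ≤ LinearMap.ker (rowEval v) := by
    rw [hK, Submodule.span_le]
    rintro _ ⟨i, rfl⟩
    exact h.triple.rowEval_relRow i
  let ψ : ((Fin 3 → S) ⧸ K) →ₗ[S] S := K.liftQ (rowEval v) hKψ
  let θ : (S × ((Fin 3 → S) ⧸ K)) →ₗ[k] S := (LinearMap.coprod LinearMap.id ψ).restrictScalars k
  let e : Fin 3 → S → (Fin 3 → S) ⧸ K := fun j s => K.mkQ (Pi.single j s)
  have he : ∀ j s, ψ (e j s) = s * v j := by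
    intro j s
    change rowEval v (Pi.single j s) = _
    rw [rowEval, Fintype.linearCombination_apply_single]
    rfl
  let el : Fin 3 → S →ₗ[k] ((Fin 3 → S) ⧸ K) := fun j =>
    ((K.mkQ).restrictScalars k) ∘ₗ (LinearMap.single k (fun _ => S) j)
  let op' : Fin 3 → Module.End k (S × ((Fin 3 → S) ⧸ K)) := fun j =>
    (LinearMap.inr k S ((Fin 3 → S) ⧸ K)) ∘ₗ (el j) ∘ₗ θ
  have hop : ∀ j t, op' j t = (0, e j (θ t)) := fun j t => rfl
  have hθ0 : ∀ w, θ (0, w) = ψ w := fun w => by simp [θ]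
  have hrow : ∀ (s : S) (i : Fin 3), e 0 (s * relRow a b c v i 0) + e 1 (s * relRow a b c v i 1)
      + e 2 (s * relRow a b c v i 2) = 0 := by
    intro s i
    simp only [e, ← map_add]
    rw [Submodule.mkQ_apply, Submodule.Quotient.mk_eq_zero]
    convert K.smul_mem s (Submodule.subset_span ⟨i, rfl⟩ : relRow a b c v i ∈ K) using 1
    ext j
    fin_cases j <;> simp
  have hsm : ∀ (r : k) j s, r • e j s = e j (r • s) := fun r j s => ((el j).map_smul r s).symm
  have htr : SklyaninTriple a b c (op (op' 0)) (op (op' 1)) (op (op' 2)) := by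
    refine ⟨?_, ?_, ?_⟩ <;> refine unop_injective (LinearMap.ext fun t => ?_) <;>
      simp only [unop_add, unop_smul, unop_mul, unop_op, LinearMap.add_apply, LinearMap.smul_apply,
        Module.End.mul_apply, hop, hθ0, he, Prod.smul_mk, Prod.mk_add_mk, smul_zero, add_zero, hsm,
        unop_zero, LinearMap.zero_apply, Prod.mk_eq_zero, true_and]
    · rw [← hrow (θ t) 0]
      simp only [relRow, Matrix.cons_val, mul_smul_comm]
      abel
    · rw [← hrow (θ t) 1]
      simp only [relRow, Matrix.cons_val, mul_smul_comm]
      abel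
    · rw [← hrow (θ t) 2]
      simp only [relRow, Matrix.cons_val, mul_smul_comm]
      abel
  obtain ⟨φ, hφ⟩ := h.lift (fun i => op (op' i)) htr
  have hact : ∀ (s : S) (t), θ ((φ s).unop t) = θ t * s := by
    intro s
    have hs : s ∈ Algebra.adjoin k (Set.range v) := h.adjoin ▸ Algebra.mem_top
    induction hs using Algebra.adjoin_induction with
    | mem x hx =>
      obtain ⟨i, rfl⟩ := hx
      intro t
      rw [hφ, unop_op, hop, hθ0, he]
    | algebraMap r =>
      intro t
      rw [AlgHom.commutes]
      simp [Algebra.algebraMap_eq_smul_one]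
    | add x y _ _ hx hy => intro t; simp [hx, hy, mul_add]
    | mul x y _ _ hx hy => intro t; simp [hx, hy, mul_assoc]
  have hzero : (φ (rowEval v α)).unop (1, 0) = 0 := by rw [hα]; simp
  have hθ1 : θ (1, 0) = 1 := by simp [θ]
  rw [rowEval_apply] at hzero
  simp only [map_add, map_mul, unop_add, unop_mul, hφ, LinearMap.add_apply, Module.End.mul_apply,
    hop, hact, hθ1, one_mul, unop_op] at hzero
  have := congrArg Prod.snd hzero
  simp only [Prod.snd_add, Prod.snd_zero, e, ← map_add] at this
  rw [Submodule.mkQ_apply, Submodule.Quotient.mk_eq_zero] at this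
  convert this using 1
  ext j
  fin_cases j <;> simp

end Koszul

end Universal

section Hilbert

variable {k : Type u} [Field k] {S : Type u} [Ring S] [Algebra k S]

theorem finrank_submodule_pi_const {M : Type*} [AddCommGroup M] [Module k M] (V : Submodule k M)
    [FiniteDimensional k V] :
    Module.finrank k (Submodule.pi (Set.univ : Set (Fin 3)) fun _ => V)
      = 3 * Module.finrank k V := by
  have h : (Submodule.pi (Set.univ : Set (Fin 3)) fun _ => V)
      = LinearMap.range (V.subtype.compLeft (Fin 3)) := by
    ext α
    simp only [Submodule.mem_pi, Set.mem_univ, true_implies, LinearMap.mem_range]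
    constructor
    · intro hα
      exact ⟨fun i => ⟨α i, hα i⟩, rfl⟩
    · rintro ⟨β, rfl⟩ i
      exact (β i).2
  have hinj : Function.Injective (V.subtype.compLeft (Fin 3)) := by
    intro α β hαβ
    ext i
    exact congrFun hαβ i
  rw [h, LinearMap.finrank_range_of_inj hinj, Module.finrank_pi_fintype]
  simp

instance finiteDimensional_submodule_pi_const {M : Type*} [AddCommGroup M] [Module k M]
    (V : Submodule k M) [FiniteDimensional k V] :
    FiniteDimensional k (Submodule.pi (Set.univ : Set (Fin 3)) fun _ => V) := by
  have h : (Submodule.pi (Set.univ : Set (Fin 3)) fun _ => V)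
      ≤ LinearMap.range (V.subtype.compLeft (Fin 3)) := by
    intro α hα
    exact ⟨fun i => ⟨α i, hα i trivial⟩, rfl⟩
  exact Submodule.finiteDimensional_of_le h

instance finiteDimensional_submodule_pow (V : Submodule k S) [FiniteDimensional k V] (n : ℕ) :
    FiniteDimensional k (V ^ n : Submodule k S) :=
  Module.Finite.iff_fg.2 ((Module.Finite.iff_fg.1 ‹_›).pow n)

variable {a b c : k} {v : Fin 3 → S}

theorem relRow_mem (i j : Fin 3) : relRow a b c v i j ∈ genSpan k v := by
  fin_cases i <;> fin_cases j <;> exact Submodule.smul_mem _ _ (gen_mem v _)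

theorem IsGrading.coeff_mul_genSpan {δ : S →ₐ[k] Polynomial S} (hδ : IsGrading v δ) (s : S) {u : S}
    (hu : u ∈ genSpan k v) (n : ℕ) : (δ (s * u)).coeff (n + 1) = (δ s).coeff n * u := by
  induction hu using Submodule.span_induction with
  | mem x hx => obtain ⟨i, rfl⟩ := hx; exact hδ.coeff_mul_gen s i n
  | zero => simp
  | add x y _ _ hx hy => rw [mul_add, map_add, Polynomial.coeff_add, hx, hy, mul_add]
  | smul r x _ hx => rw [mul_smul_comm, map_smul, Polynomial.coeff_smul, hx, mul_smul_comm]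

theorem IsSklyanin.finrank_lower (h : IsSklyanin a b c v) (n : ℕ)
    (hinj : ∀ s ∈ genSpan k v ^ n, s * v 0 = 0 → s * v 1 = 0 → s * v 2 = 0 → s = 0) :
    3 * Module.finrank k (genSpan k v ^ (n + 2) : Submodule k S)
        + Module.finrank k (genSpan k v ^ n : Submodule k S)
      ≤ Module.finrank k (genSpan k v ^ (n + 3) : Submodule k S)
        + 3 * Module.finrank k (genSpan k v ^ (n + 1) : Submodule k S) := by
  obtain ⟨δ, hδ⟩ := h.exists_grading
  let P : ℕ → Submodule k (Fin 3 → S) := fun m => Submodule.pi Set.univ fun _ => genSpan k v ^ m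
  have memP : ∀ m α, α ∈ P m ↔ ∀ i, α i ∈ genSpan k v ^ m := fun m α => by simp [P]
  let E₁ : (Fin 3 → S) →ₗ[k] S := (rowEval v).restrictScalars k
  let E₂ : (Fin 3 → S) →ₗ[k] (Fin 3 → S) :=
    (Fintype.linearCombination S (relRow a b c v)).restrictScalars k
  have hE₂ : ∀ β j, E₂ β j = β 0 * relRow a b c v 0 j + β 1 * relRow a b c v 1 j
      + β 2 * relRow a b c v 2 j := by
    intro β j
    simp [E₂, Fintype.linearCombination_apply, Fin.sum_univ_three]
  let E₃ : S →ₗ[k] (Fin 3 → S) := LinearMap.pi fun i => LinearMap.mulRight k (v i)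
  have h₁ := finrank_map_add_finrank_inf_ker E₁ (P (n + 2))
  have h₂ := finrank_map_add_finrank_inf_ker E₂ (P (n + 1))
  have h₃ := finrank_map_add_finrank_inf_ker E₃ (genSpan k v ^ n)
  have hk₃ : genSpan k v ^ n ⊓ LinearMap.ker E₃ = ⊥ := by
    rw [eq_bot_iff]
    rintro s ⟨hs, hs'⟩
    have hs'' : ∀ i, s * v i = 0 := fun i => congrFun (LinearMap.mem_ker.1 hs') i
    exact hinj s hs (hs'' 0) (hs'' 1) (hs'' 2)
  rw [hk₃, finrank_bot] at h₃
  have hm₁ : (P (n + 2)).map E₁ ≤ genSpan k v ^ (n + 3) := by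
    rintro _ ⟨α, hα, rfl⟩
    change rowEval v α ∈ _
    rw [rowEval_apply, pow_succ _ (n + 2)]
    have hα' := (memP _ _).1 hα
    exact add_mem (add_mem (Submodule.mul_mem_mul (hα' 0) (gen_mem v 0))
      (Submodule.mul_mem_mul (hα' 1) (gen_mem v 1))) (Submodule.mul_mem_mul (hα' 2) (gen_mem v 2))
  have hle₁ := Submodule.finrank_mono hm₁
  have hm₂ : P (n + 2) ⊓ LinearMap.ker E₁ ≤ (P (n + 1)).map E₂ := by
    rintro α ⟨hα, hα'⟩
    obtain ⟨β, hβ⟩ := (Submodule.mem_span_range_iff_exists_fun S).1 (h.mem_span_relRow hα')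
    refine ⟨fun i => (δ (β i)).coeff (n + 1), (memP _ _).2 fun i => hδ.coeff_mem h.adjoin _ _, ?_⟩
    ext j
    have hj : α j = E₂ β j := by
      rw [← hβ, hE₂, Fin.sum_univ_three]
      rfl
    rw [hE₂, ← hδ.coeff_mul_genSpan _ (relRow_mem 0 j), ← hδ.coeff_mul_genSpan _ (relRow_mem 1 j),
      ← hδ.coeff_mul_genSpan _ (relRow_mem 2 j), ← Polynomial.coeff_add, ← Polynomial.coeff_add,
      ← map_add, ← map_add, ← hE₂, ← hj, hδ.coeff_of_mem ((memP _ _).1 hα j), if_pos rfl]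
  have hle₂ := Submodule.finrank_mono hm₂
  have hm₃ : (genSpan k v ^ n).map E₃ ≤ P (n + 1) ⊓ LinearMap.ker E₂ := by
    rintro _ ⟨s, hs, rfl⟩
    refine ⟨(memP _ _).2 fun i => ?_, ?_⟩
    · rw [pow_succ]
      exact Submodule.mul_mem_mul hs (gen_mem v i)
    · refine LinearMap.mem_ker.2 (funext fun j => ?_)
      rw [hE₂]
      change s * v 0 * _ + s * v 1 * _ + s * v 2 * _ = 0
      rw [mul_assoc, mul_assoc, mul_assoc, ← mul_add, ← mul_add, h.triple.left_syzygy, mul_zero]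
  have hle₃ := Submodule.finrank_mono hm₃
  have hP : ∀ m, Module.finrank k (P m) = 3 * Module.finrank k (genSpan k v ^ m : Submodule k S) :=
    fun m => finrank_submodule_pi_const _
  rw [hP] at h₁ h₂
  omega

end Hilbert

section RelationMatrix

open scoped Matrix

variable {k : Type u} [Field k] {a b c : k}

theorem not_cubes_eq (hdeg : (3 * a * b * c) ^ 3 ≠ (a ^ 3 + b ^ 3 + c ^ 3) ^ 3) :
    ¬(a ^ 3 = c ^ 3 ∧ b ^ 3 = c ^ 3) := by
  rintro ⟨h₁, h₂⟩
  apply hdeg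
  rw [mul_pow, mul_pow, mul_pow, h₁, h₂]
  ring

theorem cubes_eq_of_products (habc : a * b * c ≠ 0) {x t : k} (hx : x ≠ 0)
    (h₁ : a ^ 2 * t = b * c * x ^ 2) (h₂ : b ^ 2 * t = a * c * x ^ 2)
    (h₃ : c ^ 2 * t = a * b * x ^ 2) : a ^ 3 = c ^ 3 ∧ b ^ 3 = c ^ 3 := by
  obtain ⟨hab, hc⟩ := mul_ne_zero_iff.1 habc
  obtain ⟨ha, hb⟩ := mul_ne_zero_iff.1 hab
  have ht : t ≠ 0 := by
    rintro rfl
    rw [mul_zero] at h₁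
    exact mul_ne_zero (mul_ne_zero hb hc) (pow_ne_zero 2 hx) h₁.symm
  constructor
  · have : b * x ^ 2 * t * (a ^ 3 - c ^ 3) = 0 := by
      linear_combination (a * b * x ^ 2) * h₁ - (b * c * x ^ 2) * h₃
    exact sub_eq_zero.1 ((mul_eq_zero.1 this).resolve_left
      (mul_ne_zero (mul_ne_zero hb (pow_ne_zero 2 hx)) ht))
  · have : a * x ^ 2 * t * (b ^ 3 - c ^ 3) = 0 := by
      linear_combination (a * b * x ^ 2) * h₂ - (a * c * x ^ 2) * h₃
    exact sub_eq_zero.1 ((mul_eq_zero.1 this).resolve_left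
      (mul_ne_zero (mul_ne_zero ha (pow_ne_zero 2 hx)) ht))

theorem exists_cross_relRow_ne_zero (habc : a * b * c ≠ 0)
    (hdeg : (3 * a * b * c) ^ 3 ≠ (a ^ 3 + b ^ 3 + c ^ 3) ^ 3) {p : Fin 3 → k} (hp : p ≠ 0) :
    ∃ i j, relRow a b c p i ⨯₃ relRow a b c p j ≠ 0 := by
  by_contra! h
  have e₁ := h 0 1
  have e₂ := h 1 2
  have e₃ := h 0 2
  simp only [relRow, cross_apply, Matrix.cons_val, smul_eq_mul, funext_iff, Fin.forall_fin_succ,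
    Fin.succ_zero_eq_one, Fin.succ_one_eq_two, Pi.zero_apply, IsEmpty.forall_iff, and_true]
        at e₁ e₂ e₃
  obtain ⟨p₁, p₂, p₃⟩ := e₁
  obtain ⟨q₁, q₂, q₃⟩ := e₂
  obtain ⟨r₁, r₂, r₃⟩ := e₃
  apply hp
  funext i
  by_contra hi
  apply not_cubes_eq hdeg
  fin_cases i
  · refine cubes_eq_of_products habc hi (t := p 1 * p 2) ?_ ?_ ?_ <;> simp only [Fin.zero_eta]
    · linear_combination p₂
    · linear_combination -r₃
    · linear_combination q₁
  · refine cubes_eq_of_products habc hi (t := p 0 * p 2) ?_ ?_ ?_ <;> simp only [Fin.mk_one]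
    · linear_combination q₃
    · linear_combination p₁
    · linear_combination -r₂
  · refine cubes_eq_of_products habc hi (t := p 0 * p 1) ?_ ?_ ?_ <;> simp only [Fin.reduceFinMk]
    · linear_combination -r₁
    · linear_combination q₂
    · linear_combination p₃

/-- A vector orthogonal to two rows is proportional to their cross product, modulo a submodule. -/
theorem exists_proportional {N : Type*} [AddCommGroup N] [Module k N] (I : Submodule k N)
    (w : Fin 3 → N) (p : Fin 3 → k) (hp : p ≠ 0)
    (h : ∀ j l, p l • w j - p j • w l ∈ I) :
    ∃ l, p l ≠ 0 ∧ ∀ j, w j - p j • (p l)⁻¹ • w l ∈ I := by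
  obtain ⟨l, hl⟩ := Function.ne_iff.1 hp
  refine ⟨l, hl, fun j => ?_⟩
  have := I.smul_mem (p l)⁻¹ (h j l)
  rwa [smul_sub, inv_smul_smul₀ hl, smul_comm] at this

theorem cross_smul_sub_mem {N : Type*} [AddCommGroup N] [Module k N] (I : Submodule k N)
    (w : Fin 3 → N) (r s : Fin 3 → k) (hr : r 0 • w 0 + r 1 • w 1 + r 2 • w 2 ∈ I)
    (hs : s 0 • w 0 + s 1 • w 1 + s 2 • w 2 ∈ I) (j l : Fin 3) :
    (r ⨯₃ s) l • w j - (r ⨯₃ s) j • w l ∈ I := by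
  have key : ∀ α β : k, α • (r 0 • w 0 + r 1 • w 1 + r 2 • w 2)
      + β • (s 0 • w 0 + s 1 • w 1 + s 2 • w 2) ∈ I :=
    fun α β => I.add_mem (I.smul_mem _ hr) (I.smul_mem _ hs)
  have h01 : (r ⨯₃ s) 1 • w 0 - (r ⨯₃ s) 0 • w 1 ∈ I := by
    convert key (-s 2) (r 2) using 1
    simp only [cross_apply, Matrix.cons_val]
    module
  have h02 : (r ⨯₃ s) 2 • w 0 - (r ⨯₃ s) 0 • w 2 ∈ I := by
    convert key (s 1) (-r 1) using 1
    simp only [cross_apply, Matrix.cons_val]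
    module
  have h12 : (r ⨯₃ s) 2 • w 1 - (r ⨯₃ s) 1 • w 2 ∈ I := by
    convert key (-s 0) (r 0) using 1
    simp only [cross_apply, Matrix.cons_val]
    module
  have hneg : ∀ {j l}, (r ⨯₃ s) l • w j - (r ⨯₃ s) j • w l ∈ I →
      (r ⨯₃ s) j • w l - (r ⨯₃ s) l • w j ∈ I := by
    intro j l hjl
    rw [← neg_sub]
    exact I.neg_mem hjl
  fin_cases j <;> fin_cases l
  all_goals first
    | exact h01 | exact h02 | exact h12 | exact hneg h01 | exact hneg h02 | exact hneg h12
    | (rw [sub_self]; exact I.zero_mem)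

end RelationMatrix

section UpperBound

open scoped Matrix

variable {k : Type u} [Field k] {S : Type u} [Ring S] [Algebra k S]

/-- The homogeneous components of the ideal generated by a cubic central element `g`. -/
def cubicIdeal (g : S) (V : Submodule k S) : ℕ → Submodule k S
  | 0 => ⊥
  | 1 => ⊥
  | 2 => ⊥
  | n + 3 => (V ^ n).map (LinearMap.mulLeft k g)

theorem cubicIdeal_mul_mem {g : S} {V : Submodule k S} :
    ∀ {n : ℕ} {s u : S}, s ∈ cubicIdeal g V n → u ∈ V → s * u ∈ cubicIdeal g V (n + 1) := by
  have h0 : ∀ {s u : S} {W : Submodule k S}, s ∈ (⊥ : Submodule k S) → s * u ∈ W := by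
    intro s u W hs
    rw [(Submodule.mem_bot k).1 hs, zero_mul]
    exact W.zero_mem
  intro n s u hs hu
  match n, hs with
  | 0, hs => exact h0 hs
  | 1, hs => exact h0 hs
  | 2, hs => exact h0 hs
  | n + 3, hs =>
    obtain ⟨t, ht, rfl⟩ := hs
    refine ⟨t * u, ?_, (mul_assoc _ _ _).symm⟩
    rw [pow_succ]
    exact Submodule.mul_mem_mul ht hu

theorem mul_cubicIdeal_mem {g : S} (hg : ∀ s, g * s = s * g) {V : Submodule k S} :
    ∀ {n : ℕ} {s u : S}, s ∈ cubicIdeal g V n → u ∈ V → u * s ∈ cubicIdeal g V (n + 1) := by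
  have h0 : ∀ {s u : S} {W : Submodule k S}, s ∈ (⊥ : Submodule k S) → u * s ∈ W := by
    intro s u W hs
    rw [(Submodule.mem_bot k).1 hs, mul_zero]
    exact W.zero_mem
  intro n s u hs hu
  match n, hs with
  | 0, hs => exact h0 hs
  | 1, hs => exact h0 hs
  | 2, hs => exact h0 hs
  | n + 3, hs =>
    obtain ⟨t, ht, rfl⟩ := hs
    refine ⟨u * t, ?_, ?_⟩
    · rw [pow_succ']
      exact Submodule.mul_mem_mul hu ht
    · simp only [LinearMap.mulLeft_apply]
      rw [← mul_assoc, hg, mul_assoc, hg, ← mul_assoc]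

/-- The degree `n + 1` component of the sum of the right ideal `x S` and the ideal `g S`. -/
def rightIdealPiece (x g : S) (V : Submodule k S) (n : ℕ) : Submodule k S :=
  (V ^ n).map (LinearMap.mulLeft k x) ⊔ cubicIdeal g V (n + 1)

theorem rightIdealPiece_mul_mem {x g : S} {V : Submodule k S} {n : ℕ} {s u : S}
    (hs : s ∈ rightIdealPiece x g V n) (hu : u ∈ V) : s * u ∈ rightIdealPiece x g V (n + 1) := by
  obtain ⟨_, ⟨t, ht, rfl⟩, r, hr, rfl⟩ := Submodule.mem_sup.1 hs
  rw [add_mul]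
  refine Submodule.add_mem_sup ⟨t * u, ?_, (mul_assoc _ _ _).symm⟩ (cubicIdeal_mul_mem hr hu)
  rw [pow_succ]
  exact Submodule.mul_mem_mul ht hu

variable {a b c : k} {v : Fin 3 → S}

/-- Right multiplication by the generators sends `m` to multiples of `m'`, the coefficients being
the coordinates of a point `p`, modulo `x S + g S`. -/
def PointStep (v : Fin 3 → S) (g : S) (n : ℕ) (m m' : S) (p : Fin 3 → k) : Prop :=
  m ∈ genSpan k v ^ n ∧ m' ∈ genSpan k v ^ (n + 1) ∧ p ≠ 0 ∧
    ∀ j, m * v j - p j • m' ∈ rightIdealPiece (v 0) g (genSpan k v) n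

theorem PointStep.of_cross {g : S} {n : ℕ} {m : S} {p : Fin 3 → k} (hm : m ∈ genSpan k v ^ n)
    (hp : p ≠ 0) (h : ∀ j l, p l • (m * v j) - p j • (m * v l)
      ∈ rightIdealPiece (v 0) g (genSpan k v) n) :
    ∃ m', PointStep v g n m m' p := by
  obtain ⟨l, -, hl⟩ := exists_proportional _ (fun j => m * v j) p hp h
  refine ⟨(p l)⁻¹ • (m * v l), hm, Submodule.smul_mem _ _ ?_, hp, hl⟩
  rw [pow_succ]
  exact Submodule.mul_mem_mul hm (gen_mem v l)

theorem PointStep.next (habc : a * b * c ≠ 0)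
    (hdeg : (3 * a * b * c) ^ 3 ≠ (a ^ 3 + b ^ 3 + c ^ 3) ^ 3)
    (h : SklyaninTriple a b c (v 0) (v 1) (v 2)) {g : S} {n : ℕ} {m m' : S} {p : Fin 3 → k}
    (hm : PointStep v g n m m' p) : ∃ m'', ∃ p' : Fin 3 → k, PointStep v g (n + 1) m' m'' p' := by
  obtain ⟨-, hm', hp, hstep⟩ := hm
  obtain ⟨i, j, hij⟩ := exists_cross_relRow_ne_zero habc hdeg hp
  have hI : ∀ j l, (p j • m' - m * v j) * v l ∈ rightIdealPiece (v 0) g (genSpan k v) (n + 1) := by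
    intro j l
    refine rightIdealPiece_mul_mem ?_ (gen_mem v l)
    rw [← neg_sub]
    exact neg_mem (hstep j)
  have hrow : ∀ i, relRow a b c p i 0 • (m' * v 0) + relRow a b c p i 1 • (m' * v 1)
      + relRow a b c p i 2 • (m' * v 2) ∈ rightIdealPiece (v 0) g (genSpan k v) (n + 1) := by
    set I := rightIdealPiece (v 0) g (genSpan k v) (n + 1)
    intro i
    fin_cases i
    · have e := add_mem (add_mem (I.smul_mem c (hI 0 0)) (I.smul_mem b (hI 2 1)))
        (I.smul_mem a (hI 1 2))
      convert e using 1
      have := congrArg (m * ·) h.r1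
      simp only [mul_add, mul_smul_comm, mul_zero, ← mul_assoc] at this
      simp only [relRow, Fin.zero_eta, Matrix.cons_val, sub_mul, smul_mul_assoc, smul_eq_mul]
      rw [← sub_eq_zero, ← this]
      module
    · have e := add_mem (add_mem (I.smul_mem a (hI 2 0)) (I.smul_mem c (hI 1 1)))
        (I.smul_mem b (hI 0 2))
      convert e using 1
      have := congrArg (m * ·) h.r2
      simp only [mul_add, mul_smul_comm, mul_zero, ← mul_assoc] at this
      simp only [relRow, Fin.mk_one, Matrix.cons_val, sub_mul, smul_mul_assoc, smul_eq_mul]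
      rw [← sub_eq_zero, ← this]
      module
    · have e := add_mem (add_mem (I.smul_mem b (hI 1 0)) (I.smul_mem a (hI 0 1)))
        (I.smul_mem c (hI 2 2))
      convert e using 1
      have := congrArg (m * ·) h.r3
      simp only [mul_add, mul_smul_comm, mul_zero, ← mul_assoc] at this
      simp only [relRow, Fin.reduceFinMk, Matrix.cons_val, sub_mul, smul_mul_assoc, smul_eq_mul]
      rw [← sub_eq_zero, ← this]
      module
  obtain ⟨m'', h''⟩ := PointStep.of_cross hm' hij
    (cross_smul_sub_mem _ (fun l => m' * v l) _ _ (hrow i) (hrow j))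
  exact ⟨m'', _, h''⟩

end UpperBound

section UpperBound

open scoped Matrix

variable {k : Type u} [Field k] {S : Type u} [Ring S] [Algebra k S] {a b c : k}

/-- A quadratic element realising the initial `PointStep`. -/
def quadricStart (a b : k) (y z : S) : S := b • (y * y) + a • (y * z) - a • (z * z)

/-- The point attached to `quadricStart`. -/
def pointStart (a b c : k) : Fin 3 → k :=
  ![c * (b ^ 3 - a ^ 3), b * (a ^ 3 - c ^ 3), a * (c ^ 3 - b ^ 3)]

theorem SklyaninTriple.quadricStart_mem {x y z : S} (h : SklyaninTriple a b c x y z) (hc : c ≠ 0)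
    {V : Submodule k S} (hx : x ∈ V) (hy : y ∈ V) (hz : z ∈ V) (j l : Fin 3) :
    pointStart a b c l • (quadricStart a b y z * ![x, y, z] j)
      - pointStart a b c j • (quadricStart a b y z * ![x, y, z] l)
      ∈ rightIdealPiece x (sklyaninCubic a b c x y z) V 2 := by
  set I := rightIdealPiece x (sklyaninCubic a b c x y z) V 2 with hI
  have hxI : ∀ q ∈ V ^ 2, ∀ r : k, x * q + r • sklyaninCubic a b c x y z ∈ I := by
    intro q hq r
    refine Submodule.add_mem_sup ⟨q, hq, rfl⟩ (Submodule.smul_mem _ _ ⟨1, ?_, mul_one _⟩)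
    rw [pow_zero]
    exact Submodule.one_le.1 le_rfl
  have w : ∀ {s t : S}, s ∈ V → t ∈ V → ∀ r : k, r • (s * t) ∈ V ^ 2 := by
    intro s t hs ht r
    rw [pow_two]
    exact Submodule.smul_mem _ _ (Submodule.mul_mem_mul hs ht)
  have h01 : pointStart a b c 1 • (quadricStart a b y z * x)
      - pointStart a b c 0 • (quadricStart a b y z * y) ∈ I := by
    have := h.base_xy
    simp only [pointStart, quadricStart, Matrix.cons_val]
    rw [this]
    refine hxI _ ?_ _
    repeat' first | apply w | apply add_mem | assumption
  have h02 : pointStart a b c 2 • (quadricStart a b y z * x)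
      - pointStart a b c 0 • (quadricStart a b y z * z) ∈ I := by
    have := h.base_xz
    simp only [pointStart, quadricStart, Matrix.cons_val]
    rw [this]
    refine hxI _ ?_ _
    repeat' first | apply w | apply add_mem | assumption
  have h12 : pointStart a b c 2 • (quadricStart a b y z * y)
      - pointStart a b c 1 • (quadricStart a b y z * z) ∈ I := by
    have := h.base_yz
    simp only [pointStart, quadricStart, Matrix.cons_val]
    rw [← Submodule.smul_mem_iff _ hc, this]
    refine hxI _ ?_ _
    repeat' first | apply w | apply add_mem | assumption
  have hneg : ∀ {s t : S}, s - t ∈ I → t - s ∈ I := by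
    intro s t hst
    rw [← neg_sub]
    exact I.neg_mem hst
  fin_cases j <;> fin_cases l
  all_goals first
    | exact h01 | exact h02 | exact h12 | exact hneg h01 | exact hneg h02 | exact hneg h12
    | (rw [sub_self]; exact I.zero_mem)

theorem SklyaninTriple.twist {x y z : S} (h : SklyaninTriple a b c x y z) {e : k} (he : e ^ 3 = 1) :
    SklyaninTriple a b c x (e ^ 2 • y) (e • z) := by
  refine ⟨?_, ?_, ?_⟩
  · rw [← h.r1]
    simp only [smul_mul_smul_comm, ← pow_succ, ← pow_succ', he, one_smul]
  · rw [← smul_zero e, ← h.r2]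
    simp only [smul_mul_assoc, mul_smul_comm, smul_smul, smul_add]
    rw [show c * (e ^ 2 * e ^ 2) = e * c by linear_combination c * e * he]
    module
  · rw [← smul_zero (e ^ 2), ← h.r3]
    simp only [smul_mul_assoc, mul_smul_comm, smul_smul, smul_add]
    module

theorem sklyaninCubic_twist (x y z : S) {e : k} (he : e ^ 3 = 1) :
    sklyaninCubic a b c x (e ^ 2 • y) (e • z) = sklyaninCubic a b c x y z := by
  have h6 : e ^ 2 * (e ^ 2 * e ^ 2) = 1 := by
    linear_combination (e ^ 3 + 1) * he
  simp only [sklyaninCubic, smul_mul_assoc, mul_smul_comm, smul_smul]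
  congr 1
  congr 1
  congr 1
  · congr 1
    linear_combination (c * (c ^ 3 - b ^ 3)) * h6
  · congr 1
    linear_combination (b * (c ^ 3 - a ^ 3)) * he
  · congr 1
    linear_combination (a * (b ^ 3 - c ^ 3)) * he

variable {v : Fin 3 → S}

theorem SklyaninTriple.pointStep_start (habc : a * b * c ≠ 0)
    (hdeg : (3 * a * b * c) ^ 3 ≠ (a ^ 3 + b ^ 3 + c ^ 3) ^ 3)
    (h : SklyaninTriple a b c (v 0) (v 1) (v 2)) {e : k} (he : e ^ 3 = 1) :
    ∃ m', ∃ p : Fin 3 → k, PointStep v (sklyaninCubic a b c (v 0) (v 1) (v 2)) 2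
      (quadricStart a b (e ^ 2 • v 1) (e • v 2)) m' p := by
  obtain ⟨hab, hc⟩ := mul_ne_zero_iff.1 habc
  obtain ⟨ha, hb⟩ := mul_ne_zero_iff.1 hab
  have he0 : e ≠ 0 := by
    rintro rfl
    norm_num at he
  set d : Fin 3 → k := ![1, e ^ 2, e] with hd
  have hd0 : ∀ i, d i ≠ 0 := by
    intro i
    fin_cases i
    exacts [one_ne_zero, pow_ne_zero 2 he0, he0]
  have hv : ∀ i, ![v 0, e ^ 2 • v 1, e • v 2] i = d i • v i := by
    intro i
    fin_cases i
    exacts [(one_smul k _).symm, rfl, rfl]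
  have key := (h.twist he).quadricStart_mem hc (gen_mem v 0) (Submodule.smul_mem _ _ (gen_mem v 1))
    (Submodule.smul_mem _ _ (gen_mem v 2))
  rw [sklyaninCubic_twist _ _ _ he] at key
  have hmem : quadricStart a b (e ^ 2 • v 1) (e • v 2) ∈ genSpan k v ^ 2 := by
    have w : ∀ i j, ∀ r : k, r • (d i • v i * d j • v j) ∈ genSpan k v ^ 2 := by
      intro i j r
      rw [pow_two]
      exact Submodule.smul_mem _ _ (Submodule.mul_mem_mul (Submodule.smul_mem _ _ (gen_mem v i))
        (Submodule.smul_mem _ _ (gen_mem v j)))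
    exact sub_mem (add_mem (w 1 1 b) (w 1 2 a)) (w 2 2 a)
  obtain ⟨m', hm'⟩ := PointStep.of_cross (g := sklyaninCubic a b c (v 0) (v 1) (v 2))
    (p := fun i => (d i)⁻¹ * pointStart a b c i) hmem
    (by
      intro h0
      apply not_cubes_eq hdeg
      have h0' : ∀ i, pointStart a b c i = 0 := fun i =>
        (mul_eq_zero.1 (congrFun h0 i)).resolve_left (inv_ne_zero (hd0 i))
      exact ⟨sub_eq_zero.1 ((mul_eq_zero.1 (h0' 1)).resolve_left hb),
        (sub_eq_zero.1 ((mul_eq_zero.1 (h0' 2)).resolve_left ha)).symm⟩)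
    (by
      intro j l
      have := Submodule.smul_mem _ ((d j)⁻¹ * (d l)⁻¹) (key j l)
      rw [hv, hv, mul_smul_comm, mul_smul_comm] at this
      convert this using 1
      rw [smul_sub, smul_smul, smul_smul, smul_smul, smul_smul]
      congr 2
      · field_simp [hd0 j, hd0 l]
      · field_simp [hd0 j, hd0 l])
  exact ⟨m', _, hm'⟩

theorem genSpan_pow_succ_le {g : S} {n : ℕ} {m m' : Fin 3 → S} {p : Fin 3 → Fin 3 → k}
    (hs : ∀ i, PointStep v g (n + 1) (m i) (m' i) (p i))
    (hle : genSpan k v ^ (n + 1) ≤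
      rightIdealPiece (v 0) g (genSpan k v) n ⊔ Submodule.span k (Set.range m)) :
    genSpan k v ^ (n + 2) ≤
      rightIdealPiece (v 0) g (genSpan k v) (n + 1) ⊔ Submodule.span k (Set.range m') := by
  rw [pow_succ _ (n + 1), Submodule.mul_le]
  intro s hs' t ht
  set T := rightIdealPiece (v 0) g (genSpan k v) (n + 1) ⊔ Submodule.span k (Set.range m') with hT
  obtain ⟨s₁, hs₁, s₂, hs₂, rfl⟩ := Submodule.mem_sup.1 (hle hs')
  rw [add_mul]
  refine add_mem (Submodule.mem_sup_left (rightIdealPiece_mul_mem hs₁ ht)) ?_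
  have : Submodule.span k (Set.range m) * genSpan k v ≤ T := by
    rw [Submodule.span_mul_span, Submodule.span_le]
    rintro _ ⟨_, ⟨i, rfl⟩, _, ⟨j, rfl⟩, rfl⟩
    change m i * v j ∈ T
    rw [← sub_add_cancel (m i * v j) (p i j • m' i)]
    exact add_mem (Submodule.mem_sup_left ((hs i).2.2.2 j))
      (T.smul_mem _ (Submodule.mem_sup_right (Submodule.subset_span ⟨i, rfl⟩)))
  exact this (Submodule.mul_mem_mul hs₂ ht)

theorem SklyaninTriple.genSpan_sq_le [CharZero k] (habc : a * b * c ≠ 0)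
    (h : SklyaninTriple a b c (v 0) (v 1) (v 2)) (g : S) {w : k} (hw : w ^ 2 + w + 1 = 0) :
    genSpan k v ^ 2 ≤ rightIdealPiece (v 0) g (genSpan k v) 1 ⊔ Submodule.span k
      (Set.range fun i : Fin 3 => quadricStart a b ((w ^ (i : ℕ)) ^ 2 • v 1) (w ^ (i : ℕ) • v 2)) := by
  obtain ⟨hab, hc⟩ := mul_ne_zero_iff.1 habc
  obtain ⟨ha, hb⟩ := mul_ne_zero_iff.1 hab
  set q := fun i : Fin 3 => quadricStart a b ((w ^ (i : ℕ)) ^ 2 • v 1) (w ^ (i : ℕ) • v 2) with hq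
  set T := rightIdealPiece (v 0) g (genSpan k v) 1 ⊔ Submodule.span k (Set.range q) with hT
  have hqT : ∀ i, q i ∈ T := fun i => Submodule.mem_sup_right (Submodule.subset_span ⟨i, rfl⟩)
  have hx : ∀ i, v 0 * v i ∈ T := by
    intro i
    refine Submodule.mem_sup_left (Submodule.mem_sup_left ⟨v i, ?_, rfl⟩)
    rw [pow_one]
    exact gen_mem v i
  have hcomb : ∀ α β γ : k, α • q 0 + β • q 1 + γ • q 2 ∈ T := fun α β γ =>
    add_mem (add_mem (T.smul_mem _ (hqT 0)) (T.smul_mem _ (hqT 1))) (T.smul_mem _ (hqT 2))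
  have h3 : (3 : k) ≠ 0 := by norm_num
  have hw3 : w ^ 3 = 1 := by linear_combination (w - 1) * hw
  have hw2 : w ^ 2 = -w - 1 := by linear_combination hw
  have hw4 : w ^ 4 = w := by linear_combination w * hw3
  have hw6 : w ^ 6 = 1 := by linear_combination (w ^ 3 + 1) * hw3
  have hw8 : w ^ 8 = -w - 1 := by linear_combination (w ^ 5 + w ^ 2) * hw3 + hw
  have hq0 : q 0 = b • (v 1 * v 1) + a • (v 1 * v 2) - a • (v 2 * v 2) := by
    simp [hq, quadricStart]
  have hq1 : q 1 = (b * w) • (v 1 * v 1) + a • (v 1 * v 2) + (a * (w + 1)) • (v 2 * v 2) := by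
    simp only [hq, quadricStart, Fin.val_one, pow_one, smul_mul_smul_comm, smul_smul]
    rw [show b * (w ^ 2 * w ^ 2) = b * w by linear_combination b * hw4,
      show a * (w ^ 2 * w) = a by linear_combination a * hw3,
      show a * (w * w) = -(a * (w + 1)) by linear_combination a * hw2, neg_smul, sub_neg_eq_add]
  have hq2 : q 2 = (-(b * (w + 1))) • (v 1 * v 1) + a • (v 1 * v 2) - (a * w) • (v 2 * v 2) := by
    simp only [hq, quadricStart, Fin.val_two, smul_mul_smul_comm, smul_smul]
    rw [show b * ((w ^ 2) ^ 2 * (w ^ 2) ^ 2) = -(b * (w + 1)) by linear_combination b * hw8,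
      show a * ((w ^ 2) ^ 2 * w ^ 2) = a by linear_combination a * hw6,
      show a * (w ^ 2 * w ^ 2) = a * w by linear_combination a * hw4]
  have hyz : v 1 * v 2 ∈ T := by
    rw [← Submodule.smul_mem_iff _ (mul_ne_zero h3 ha)]
    convert hcomb 1 1 1 using 1
    rw [hq0, hq1, hq2]
    module
  have hyy : v 1 * v 1 ∈ T := by
    rw [← Submodule.smul_mem_iff _ (mul_ne_zero h3 hb)]
    convert hcomb 1 (-w - 1) w using 1
    rw [hq0, hq1, hq2]
    match_scalars
    · linear_combination (2 * b) * hw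
    · ring
    · linear_combination (2 * a) * hw
  have hzz : v 2 * v 2 ∈ T := by
    rw [← Submodule.smul_mem_iff _ (neg_ne_zero.2 (mul_ne_zero h3 ha))]
    convert hcomb 1 w (-w - 1) using 1
    rw [hq0, hq1, hq2]
    match_scalars
    · linear_combination -(2 * a) * hw
    · linear_combination -(2 * b) * hw
    · ring
  have hzy : v 2 * v 1 ∈ T := by
    rw [← Submodule.smul_mem_iff _ hb]
    have := h.r1
    convert T.neg_mem (add_mem (T.smul_mem a hyz) (T.smul_mem c (hx 0))) using 1
    rw [← sub_eq_zero, ← this]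
    module
  have hzx : v 2 * v 0 ∈ T := by
    rw [← Submodule.smul_mem_iff _ ha]
    have := h.r2
    convert T.neg_mem (add_mem (T.smul_mem b (hx 2)) (T.smul_mem c hyy)) using 1
    rw [← sub_eq_zero, ← this]
    module
  have hyx : v 1 * v 0 ∈ T := by
    rw [← Submodule.smul_mem_iff _ hb]
    have := h.r3
    convert T.neg_mem (add_mem (T.smul_mem a (hx 1)) (T.smul_mem c hzz)) using 1
    rw [← sub_eq_zero, ← this]
    module
  rw [pow_two, Submodule.span_mul_span, Submodule.span_le]
  rintro _ ⟨_, ⟨i, rfl⟩, _, ⟨j, rfl⟩, rfl⟩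
  change v i * v j ∈ T
  fin_cases i <;> fin_cases j
  exacts [hx 0, hx 1, hx 2, hyx, hyy, hyz, hzx, hzy, hzz]

theorem IsAlgClosed.exists_sq_add_self_add_one [IsAlgClosed k] [CharZero k] :
    ∃ w : k, w ^ 2 + w + 1 = 0 := by
  obtain ⟨s, hs⟩ := IsAlgClosed.exists_pow_nat_eq (-3 : k) (n := 2) two_pos
  exact ⟨(s - 1) / 2, by linear_combination hs / 4⟩

theorem SklyaninTriple.exists_spanning [IsAlgClosed k] [CharZero k] (habc : a * b * c ≠ 0)
    (hdeg : (3 * a * b * c) ^ 3 ≠ (a ^ 3 + b ^ 3 + c ^ 3) ^ 3)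
    (h : SklyaninTriple a b c (v 0) (v 1) (v 2)) (n : ℕ) :
    ∃ (m m' : Fin 3 → S) (p : Fin 3 → Fin 3 → k),
      (∀ i, PointStep v (sklyaninCubic a b c (v 0) (v 1) (v 2)) (n + 2) (m i) (m' i) (p i)) ∧
      genSpan k v ^ (n + 2) ≤
        rightIdealPiece (v 0) (sklyaninCubic a b c (v 0) (v 1) (v 2)) (genSpan k v) (n + 1)
          ⊔ Submodule.span k (Set.range m) := by
  induction n with
  | zero =>
    obtain ⟨w, hw⟩ := IsAlgClosed.exists_sq_add_self_add_one (k := k)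
    have hw3 : w ^ 3 = 1 := by linear_combination (w - 1) * hw
    choose m' p hp using fun i : Fin 3 => h.pointStep_start habc hdeg
      (e := w ^ (i : ℕ)) (by rw [pow_right_comm, hw3, one_pow])
    exact ⟨_, m', p, hp, h.genSpan_sq_le habc _ hw⟩
  | succ n ih =>
    obtain ⟨m, m', p, hs, hle⟩ := ih
    choose m'' p' hp' using fun i => (hs i).next habc hdeg h
    exact ⟨m', m'', p', hp', genSpan_pow_succ_le hs hle⟩

theorem IsSklyanin.cubic_mul (h : IsSklyanin a b c v) (s : S) :
    sklyaninCubic a b c (v 0) (v 1) (v 2) * s = s * sklyaninCubic a b c (v 0) (v 1) (v 2) := by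
  have hs : s ∈ Algebra.adjoin k (Set.range v) := h.adjoin ▸ Algebra.mem_top
  induction hs using Algebra.adjoin_induction with
  | mem x hx =>
    obtain ⟨i, rfl⟩ := hx
    fin_cases i
    exacts [h.triple.cubic_mul_x, h.triple.cubic_mul_y, h.triple.cubic_mul_z]
  | algebraMap r => exact (Algebra.commutes r _).symm
  | add x y _ _ hx hy => rw [mul_add, add_mul, hx, hy]
  | mul x y _ _ hx hy => rw [← mul_assoc, hx, mul_assoc, hy, mul_assoc]

theorem IsSklyanin.exists_complement [IsAlgClosed k] [CharZero k] (habc : a * b * c ≠ 0)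
    (hdeg : (3 * a * b * c) ^ 3 ≠ (a ^ 3 + b ^ 3 + c ^ 3) ^ 3)
    (h : IsSklyanin a b c v) (n : ℕ) :
    ∃ C : Submodule k S, FiniteDimensional k C ∧ Module.finrank k C ≤ 3 * (n + 1) ∧
      genSpan k v ^ (n + 1) ≤ C ⊔
        cubicIdeal (sklyaninCubic a b c (v 0) (v 1) (v 2)) (genSpan k v) (n + 1) := by
  set g := sklyaninCubic a b c (v 0) (v 1) (v 2) with hg
  induction n with
  | zero =>
    refine ⟨genSpan k v, inferInstance, ?_, by rw [zero_add, pow_one]; exact le_sup_left⟩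
    exact (finrank_range_le_card (R := k) v).trans (by simp)
  | succ n ih =>
    obtain ⟨C, hCf, hCd, hC⟩ := ih
    obtain ⟨m, -, -, -, hle⟩ := h.triple.exists_spanning habc hdeg n
    have hgx : ∀ s ∈ cubicIdeal g (genSpan k v) (n + 1),
        v 0 * s ∈ cubicIdeal g (genSpan k v) (n + 2) :=
      fun s hs => mul_cubicIdeal_mem h.cubic_mul hs (gen_mem v 0)
    refine ⟨C.map (LinearMap.mulLeft k (v 0)) ⊔ Submodule.span k (Set.range m), ?_, ?_, ?_⟩
    · have := FiniteDimensional.span_of_finite k (Set.finite_range m)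
      infer_instance
    · have h₁ := Submodule.finrank_add_le_finrank_add_finrank
        (C.map (LinearMap.mulLeft k (v 0))) (Submodule.span k (Set.range m))
      have h₂ := Submodule.finrank_map_le (LinearMap.mulLeft k (v 0)) C
      have h₃ : Module.finrank k (Submodule.span k (Set.range m)) ≤ 3 := by
        exact (finrank_range_le_card (R := k) m).trans (by simp)
      omega
    · refine hle.trans (sup_le (sup_le ?_ le_sup_right) (le_sup_right.trans le_sup_left))
      rintro _ ⟨s, hs, rfl⟩
      obtain ⟨s₁, hs₁, s₂, hs₂, rfl⟩ := Submodule.mem_sup.1 (hC hs)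
      rw [map_add]
      exact add_mem (Submodule.mem_sup_left (Submodule.mem_sup_left ⟨s₁, hs₁, rfl⟩))
        (Submodule.mem_sup_right (hgx s₂ hs₂))

end UpperBound

section Curve

open scoped Matrix

variable {k : Type u} [Field k] {a b c : k}

/-- The cubic form whose zero locus parametrises the point modules. -/
def cubicForm (a b c : k) (p : Fin 3 → k) : k :=
  (a ^ 3 + b ^ 3 + c ^ 3) * (p 0 * p 1 * p 2) - a * b * c * (p 0 ^ 3 + p 1 ^ 3 + p 2 ^ 3)

theorem det_relRow (p : Fin 3 → k) : (Matrix.of (relRow a b c p)).det = cubicForm a b c p := by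
  rw [Matrix.det_fin_three]
  simp only [relRow, cubicForm, Matrix.of_apply, Matrix.cons_val, smul_eq_mul]
  ring

/-- The bilinear relations between a point and its successor. -/
def Successor (a b c : k) (p q : Fin 3 → k) : Prop := Matrix.of (relRow a b c p) *ᵥ q = 0

theorem successor_iff {p q : Fin 3 → k} : Successor a b c p q ↔
    (c * (p 0 * q 0) + b * (p 2 * q 1) + a * (p 1 * q 2) = 0 ∧
      a * (p 2 * q 0) + c * (p 1 * q 1) + b * (p 0 * q 2) = 0 ∧
      b * (p 1 * q 0) + a * (p 0 * q 1) + c * (p 2 * q 2) = 0) := by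
  simp only [Successor, funext_iff, Fin.forall_fin_succ, relRow, Matrix.mulVec, dotProduct,
    Fin.sum_univ_three, Matrix.of_apply, Matrix.cons_val, smul_eq_mul, Pi.zero_apply,
    Fin.succ_zero_eq_one, Fin.succ_one_eq_two, IsEmpty.forall_iff, and_true, mul_assoc]

theorem Successor.symm {p q : Fin 3 → k} (h : Successor a b c p q) : Successor b a c q p := by
  rw [successor_iff] at h ⊢
  obtain ⟨h₁, h₂, h₃⟩ := h
  exact ⟨by linear_combination h₁, by linear_combination h₂, by linear_combination h₃⟩

theorem cubicForm_swap (p : Fin 3 → k) : cubicForm b a c p = cubicForm a b c p := by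
  simp only [cubicForm]
  ring

theorem cubicForm_smul (r : k) (p : Fin 3 → k) :
    cubicForm a b c (r • p) = r ^ 3 * cubicForm a b c p := by
  simp only [cubicForm, Pi.smul_apply, smul_eq_mul]
  ring

theorem Successor.smul_right {p q : Fin 3 → k} (h : Successor a b c p q) (r : k) :
    Successor a b c p (r • q) := by
  rw [Successor] at h ⊢
  rw [Matrix.mulVec_smul, h, smul_zero]

theorem Successor.cubicForm_left {p q : Fin 3 → k} (h : Successor a b c p q) (hq : q ≠ 0) :
    cubicForm a b c p = 0 := by
  rw [← det_relRow]
  exact Matrix.exists_mulVec_eq_zero_iff.1 ⟨q, hq, h⟩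

theorem Successor.cubicForm_right {p q : Fin 3 → k} (h : Successor a b c p q) (hp : p ≠ 0) :
    cubicForm a b c q = 0 := by
  rw [← cubicForm_swap]
  exact h.symm.cubicForm_left hp

theorem exists_successor {p : Fin 3 → k} (hp : cubicForm a b c p = 0) :
    ∃ q, q ≠ 0 ∧ Successor a b c p q :=
  Matrix.exists_mulVec_eq_zero_iff.2 ((det_relRow p).trans hp)

theorem Successor.unique (habc : a * b * c ≠ 0)
    (hdeg : (3 * a * b * c) ^ 3 ≠ (a ^ 3 + b ^ 3 + c ^ 3) ^ 3) {p q q' : Fin 3 → k} (hp : p ≠ 0)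
    (h : Successor a b c p q) (h' : Successor a b c p q') (hq' : q' ≠ 0) : ∃ r : k, q = r • q' := by
  obtain ⟨i, j, hij⟩ := exists_cross_relRow_ne_zero habc hdeg hp
  have key : ∀ {q : Fin 3 → k}, Successor a b c p q →
      ∃ r : k, q = r • (relRow a b c p i ⨯₃ relRow a b c p j) := by
    intro q h
    have hrow : ∀ i, relRow a b c p i 0 • q 0 + relRow a b c p i 1 • q 1 + relRow a b c p i 2 • q 2
        ∈ (⊥ : Submodule k k) := by
      intro i
      have := congrFun h i
      rw [Matrix.mulVec, dotProduct, Fin.sum_univ_three] at this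
      exact this
    obtain ⟨l, -, hl⟩ := exists_proportional _ q _ hij
      (cross_smul_sub_mem _ q _ _ (hrow i) (hrow j))
    refine ⟨((relRow a b c p i ⨯₃ relRow a b c p j) l)⁻¹ * q l,
      funext fun m => (sub_eq_zero.1 (hl m)).trans ?_⟩
    rw [Pi.smul_apply, smul_eq_mul, smul_eq_mul, mul_comm]
    rfl
  obtain ⟨r, hr⟩ := key h
  obtain ⟨r', hr'⟩ := key h'
  have hr0 : r' ≠ 0 := by
    rintro rfl
    exact hq' (hr'.trans (zero_smul _ _))
  exact ⟨r * r'⁻¹, by rw [hr', smul_smul, mul_assoc, inv_mul_cancel₀ hr0, mul_one, hr]⟩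

/-- Normalised representatives of the points of the projective cubic curve. -/
def CurvePoint (a b c : k) : Type u :=
  {p : Fin 3 → k // cubicForm a b c p = 0 ∧ (p 2 = 1 ∨ p 2 = 0 ∧ p 1 = 1)}

namespace CurvePoint

theorem ne_zero (P : CurvePoint a b c) : P.1 ≠ 0 := by
  intro h
  rcases P.2.2 with h' | ⟨-, h'⟩ <;> rw [h] at h' <;> exact zero_ne_one h'

theorem eq_of_smul {P Q : CurvePoint a b c} {r : k} (h : P.1 = r • Q.1) : P = Q := by
  suffices r = 1 by
    rw [this, one_smul] at h
    exact Subtype.ext h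
  have h1 := congrFun h 1
  have h2 := congrFun h 2
  rw [Pi.smul_apply, smul_eq_mul] at h1 h2
  rcases Q.2.2 with hQ | ⟨hQ, hQ'⟩
  · rw [hQ, mul_one] at h2
    rcases P.2.2 with hP | ⟨hP, hP'⟩
    · rw [← h2, hP]
    · rw [hP] at h2
      rw [← h2, hP', zero_mul] at h1
      exact absurd h1 one_ne_zero
  · rw [hQ, mul_zero] at h2
    rcases P.2.2 with hP | ⟨hP, hP'⟩
    · rw [hP] at h2
      exact absurd h2 one_ne_zero
    · rw [hP', hQ', mul_one] at h1
      exact h1.symm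

theorem exists_normalized (habc : a * b * c ≠ 0) {p : Fin 3 → k} (hp : p ≠ 0)
    (h : cubicForm a b c p = 0) : ∃ (P : CurvePoint a b c) (r : k), P.1 = r • p := by
  by_cases h2 : p 2 = 0
  · have h1 : p 1 ≠ 0 := by
      intro h1
      have h0 : p 0 = 0 := by
        rw [cubicForm, h1, h2] at h
        have : a * b * c * p 0 ^ 3 = 0 := by linear_combination -h
        exact pow_eq_zero_iff three_ne_zero |>.1 ((mul_eq_zero.1 this).resolve_left habc)
      apply hp
      funext i
      fin_cases i
      exacts [h0, h1, h2]
    refine ⟨⟨(p 1)⁻¹ • p, by rw [cubicForm_smul, h, mul_zero], Or.inr ⟨?_, ?_⟩⟩, _, rfl⟩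
    · rw [Pi.smul_apply, h2, smul_zero]
    · rw [Pi.smul_apply, smul_eq_mul, inv_mul_cancel₀ h1]
  · refine ⟨⟨(p 2)⁻¹ • p, by rw [cubicForm_smul, h, mul_zero], Or.inl ?_⟩, _, rfl⟩
    rw [Pi.smul_apply, smul_eq_mul, inv_mul_cancel₀ h2]

theorem exists_succ (habc : a * b * c ≠ 0) (P : CurvePoint a b c) :
    ∃ Q : CurvePoint a b c, Successor a b c P.1 Q.1 := by
  obtain ⟨q, hq, hPq⟩ := exists_successor P.2.1
  obtain ⟨Q, r, hQ⟩ := exists_normalized habc hq (hPq.cubicForm_right P.ne_zero)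
  exact ⟨Q, hQ ▸ hPq.smul_right r⟩

/-- The automorphism of the curve given by the successor relation. -/
theorem exists_equiv (habc : a * b * c ≠ 0)
    (hdeg : (3 * a * b * c) ^ 3 ≠ (a ^ 3 + b ^ 3 + c ^ 3) ^ 3) :
    ∃ σ : CurvePoint a b c ≃ CurvePoint a b c, ∀ P, Successor a b c P.1 (σ P).1 := by
  have habc' : b * a * c ≠ 0 := by rwa [mul_comm b a]
  have hdeg' : (3 * b * a * c) ^ 3 ≠ (b ^ 3 + a ^ 3 + c ^ 3) ^ 3 := by
    rwa [mul_right_comm 3 b a, add_comm (b ^ 3)]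
  choose f hf using exists_succ habc (a := a) (b := b) (c := c)
  refine ⟨Equiv.ofBijective f ⟨fun P P' hP => ?_, fun Q => ?_⟩, hf⟩
  · have h := (hf P).symm
    rw [hP] at h
    obtain ⟨r, hr⟩ := h.unique habc' hdeg' (f P').ne_zero (hf P').symm P'.ne_zero
    exact eq_of_smul hr
  · obtain ⟨q, hq, hPq⟩ := exists_successor (a := b) (b := a) (c := c) (p := Q.1)
      ((cubicForm_swap Q.1).trans Q.2.1)
    obtain ⟨P, r, hP⟩ := exists_normalized habc hq (hPq.symm.cubicForm_left Q.ne_zero)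
    have hPQ : Successor a b c P.1 Q.1 := hP ▸ (hPq.smul_right r).symm
    obtain ⟨r', hr'⟩ := (hf P).unique habc hdeg P.ne_zero hPQ Q.ne_zero
    exact ⟨P, eq_of_smul hr'⟩

theorem exists_separating {P Q : CurvePoint a b c} (h : P ≠ Q) :
    ∃ α : Fin 3 → k, α ⬝ᵥ P.1 = 0 ∧ α ⬝ᵥ Q.1 ≠ 0 := by
  by_contra! hcon
  have h1 := hcon ![P.1 1, -P.1 0, 0] (by simp [dotProduct, Fin.sum_univ_three]; ring)
  have h2 := hcon ![P.1 2, 0, -P.1 0] (by simp [dotProduct, Fin.sum_univ_three]; ring)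
  have h3 := hcon ![0, P.1 2, -P.1 1] (by simp [dotProduct, Fin.sum_univ_three]; ring)
  simp only [dotProduct, Fin.sum_univ_three, Matrix.cons_val, zero_mul, add_zero, zero_add]
      at h1 h2 h3
  apply h
  symm
  rcases P.2.2 with hP | ⟨hP, hP'⟩
  · refine eq_of_smul (r := Q.1 2) (funext fun i => ?_)
    rw [Pi.smul_apply, smul_eq_mul]
    fin_cases i <;> simp only [Fin.zero_eta, Fin.mk_one, Fin.reduceFinMk]
    · linear_combination h2 - Q.1 0 * hP
    · linear_combination h3 - Q.1 1 * hP
    · linear_combination -Q.1 2 * hP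
  · refine eq_of_smul (r := Q.1 1) (funext fun i => ?_)
    rw [Pi.smul_apply, smul_eq_mul]
    fin_cases i <;> simp only [Fin.zero_eta, Fin.mk_one, Fin.reduceFinMk]
    · linear_combination h1 - Q.1 0 * hP'
    · linear_combination -Q.1 1 * hP'
    · linear_combination -h3 - Q.1 2 * hP'

theorem exists_form_ne_zero (P : CurvePoint a b c) : ∃ α : Fin 3 → k, α ⬝ᵥ P.1 ≠ 0 := by
  obtain ⟨i, hi⟩ := Function.ne_iff.1 P.ne_zero
  exact ⟨Pi.single i 1, by rwa [single_one_dotProduct]⟩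

end CurvePoint

end Curve

section AffineCubic

open Polynomial

variable {k : Type u} [Field k]

/-- The affine Hesse cubic `Y³ - t X Y + X³ + 1`. -/
def affineCubic (t : k) : k[X][X] := X ^ 3 + C (-(C t * X)) * X + C (X ^ 3 + 1)

theorem affineCubic_natDegree (t : k) : (affineCubic t).natDegree = 3 := by
  unfold affineCubic
  compute_degree!

theorem affineCubic_monic (t : k) : (affineCubic t).Monic := by
  unfold affineCubic
  monicity!

theorem evalEval_affineCubic (t x y : k) :
    evalEval x y (affineCubic t) = y ^ 3 - t * x * y + x ^ 3 + 1 := by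
  simp only [affineCubic, evalEval, eval_add, eval_mul, eval_pow, eval_X, eval_C, eval_neg,
      eval_one]
  ring

theorem affineCubic_irreducible {t : k} (ht : t ^ 3 ≠ 27) : Irreducible (affineCubic t) := by
  rw [(affineCubic_monic t).irreducible_iff_roots_eq_zero_of_degree_le_three
    (by rw [affineCubic_natDegree]; norm_num) (affineCubic_natDegree t).le]
  refine Multiset.eq_zero_of_forall_notMem fun r hr => ht ?_
  have hroot : r ^ 3 + -(C t * X) * r + (X ^ 3 + 1) = 0 := by
    have := (mem_roots'.1 hr).2
    simpa only [affineCubic, IsRoot.def, eval_add, eval_mul, eval_pow, eval_X, eval_C] using this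
  have hdeg : r.natDegree ≤ 1 := by
    by_contra! h
    have h1 : r ^ 3 = C t * X * r - (X ^ 3 + 1) := by linear_combination hroot
    have h2 : (r ^ 3).natDegree ≤ max (1 + r.natDegree) 3 := by
      rw [h1]
      refine (natDegree_sub_le _ _).trans (max_le_max ?_ ?_)
      · exact natDegree_mul_le.trans (Nat.add_le_add_right (by compute_degree) _)
      · compute_degree
    rw [natDegree_pow] at h2
    omega
  obtain ⟨α, β, rfl⟩ := exists_eq_X_add_C_of_natDegree_le_one hdeg
  have hexp : C (α ^ 3 + 1) * X ^ 3 + C (3 * α ^ 2 * β - t * α) * X ^ 2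
      + C (3 * α * β ^ 2 - t * β) * X + C (β ^ 3 + 1) = 0 := by
    rw [← hroot]
    simp only [map_add, map_sub, map_mul, map_pow, map_one, map_ofNat]
    ring
  have hcoeff : ∀ p q r s : k, C p * X ^ 3 + C q * X ^ 2 + C r * X + C s = 0 →
      p = 0 ∧ q = 0 ∧ s = 0 :=
    fun p q r s h => ⟨by simpa [coeff_X, coeff_C] using congrArg (coeff · 3) h,
      by simpa [coeff_X, coeff_C] using congrArg (coeff · 2) h,
      by simpa [coeff_X, coeff_C] using congrArg (coeff · 0) h⟩
  obtain ⟨c3, c2, c0⟩ := hcoeff _ _ _ _ hexp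
  have hα : α ≠ 0 := by
    rintro rfl
    simp at c3
  have : t = 3 * α * β := mul_left_cancel₀ hα (by linear_combination -c2)
  rw [this]
  linear_combination 27 * β ^ 3 * c3 - 27 * c0

/-- Eliminating the second variable from a polynomial coprime to the cubic. -/
theorem exists_eliminant {t : k} (ht : t ^ 3 ≠ 27) {B : k[X][X]} (hB : ¬ affineCubic t ∣ B) :
    ∃ (q : k[X]) (H U : k[X][X]), q ≠ 0 ∧ C q = B * H + affineCubic t * U := by
  have : Fact (Prime (affineCubic t)) := ⟨(affineCubic_irreducible ht).prime⟩
  have : IsDomain (AdjoinRoot (affineCubic t)) := AdjoinRoot.isDomain_of_prime Fact.out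
  have : Module.Finite k[X] (AdjoinRoot (affineCubic t)) := (affineCubic_monic t).finite_adjoinRoot
  have hne := Ideal.comap_ne_bot_of_integral_mem (R := k[X]) (mt AdjoinRoot.mk_eq_zero.1 hB)
    (Ideal.mem_span_singleton_self (AdjoinRoot.mk (affineCubic t) B))
    (Algebra.IsIntegral.isIntegral _)
  obtain ⟨q, hq, hq0⟩ := Submodule.exists_mem_ne_zero_of_ne_bot hne
  obtain ⟨h, hh⟩ := Ideal.mem_span_singleton'.1 (Ideal.mem_comap.1 hq)
  obtain ⟨H, rfl⟩ := AdjoinRoot.mk_surjective h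
  obtain ⟨U, hU⟩ := AdjoinRoot.mk_eq_mk.1
    (show AdjoinRoot.mk (affineCubic t) (C q) = AdjoinRoot.mk (affineCubic t) (H * B) by
      rw [map_mul, hh]
      rfl)
  exact ⟨q, H, U, hq0, by linear_combination hU⟩

end AffineCubic

section CurveFunctions

open Polynomial Filter
open scoped Matrix

variable {k : Type u} [Field k] {a b c : k}

namespace CurvePoint

/-- The parameter of the affine Hesse cubic attached to `a, b, c`. -/
def hesse (a b c : k) : k := (a ^ 3 + b ^ 3 + c ^ 3) / (a * b * c)

theorem hesse_cube_ne (habc : a * b * c ≠ 0)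
    (hdeg : (3 * a * b * c) ^ 3 ≠ (a ^ 3 + b ^ 3 + c ^ 3) ^ 3) : hesse a b c ^ 3 ≠ 27 := by
  intro h
  rw [hesse, div_pow, div_eq_iff (pow_ne_zero 3 habc)] at h
  exact hdeg (by rw [h]; ring)

theorem equation (habc : a * b * c ≠ 0) (P : CurvePoint a b c) :
    P.1 0 ^ 3 + P.1 1 ^ 3 + P.1 2 ^ 3 - hesse a b c * (P.1 0 * P.1 1 * P.1 2) = 0 := by
  have h := P.2.1
  rw [cubicForm] at h
  have h' : a ^ 3 + b ^ 3 + c ^ 3 = hesse a b c * (a * b * c) := (div_mul_cancel₀ _ habc).symm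
  rw [h'] at h
  exact mul_left_cancel₀ habc (by linear_combination -h)

theorem finite_fibre (habc : a * b * c ≠ 0) (x z : k) :
    {P : CurvePoint a b c | P.1 0 = x ∧ P.1 2 = z}.Finite := by
  classical
  let q : k[X] := X ^ 3 + C (-hesse a b c * (x * z)) * X + C (x ^ 3 + z ^ 3)
  have hq : q.Monic := by
    unfold q
    monicity!
  refine Set.Finite.of_finite_image (f := fun P : CurvePoint a b c => P.1 1)
    (q.roots.toFinset.finite_toSet.subset ?_) ?_
  · rintro _ ⟨P, ⟨hx, hz⟩, rfl⟩
    rw [Finset.mem_coe, Multiset.mem_toFinset, mem_roots hq.ne_zero, IsRoot.def]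
    have := equation habc P
    simp only [q, eval_add, eval_mul, eval_pow, eval_X, eval_C, ← hx, ← hz]
    linear_combination this
  · rintro P ⟨hx, hz⟩ Q ⟨hx', hz'⟩ h
    refine Subtype.ext (funext fun i => ?_)
    fin_cases i
    exacts [hx.trans hx'.symm, h, hz.trans hz'.symm]

theorem finite_zeros (habc : a * b * c ≠ 0) {q : k[X]} (hq : q ≠ 0) :
    {P : CurvePoint a b c | q.eval (P.1 0) = 0}.Finite := by
  classical
  refine (Set.Finite.biUnion q.roots.toFinset.finite_toSet fun x _ =>
    (finite_fibre habc x 1).union (finite_fibre habc x 0)).subset fun P hP => ?_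
  refine Set.mem_biUnion (x := P.1 0) (by simpa [hq] using hP) ?_
  rcases P.2.2 with h | ⟨h, -⟩
  exacts [Or.inl ⟨rfl, h⟩, Or.inr ⟨rfl, h⟩]

theorem eventually_affine (habc : a * b * c ≠ 0) :
    ∀ᶠ P : CurvePoint a b c in cofinite, P.1 2 = 1 := by
  refine (finite_zeros habc (X_pow_add_C_ne_zero (n := 3) three_pos (1 : k))).subset fun P hP => ?_
  rcases P.2.2 with h | ⟨h, h'⟩
  · exact absurd h hP
  · have := equation habc P
    rw [h, h'] at this
    simp only [Set.mem_ofPred_eq, eval_add, eval_pow, eval_X, eval_C]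
    linear_combination this

/-- Evaluation of polynomials in the affine coordinates. -/
def evalAffine (P : CurvePoint a b c) : k[X][X] →+* k := evalEvalRingHom (P.1 0) (P.1 1)

theorem evalAffine_affineCubic (habc : a * b * c ≠ 0) {P : CurvePoint a b c} (hP : P.1 2 = 1) :
    P.evalAffine (affineCubic (hesse a b c)) = 0 := by
  have := equation habc P
  rw [hP] at this
  rw [evalAffine, coe_evalEvalRingHom, evalEval_affineCubic]
  linear_combination this

theorem eventually_eq_zero (habc : a * b * c ≠ 0) {A : k[X][X]}
    (hA : affineCubic (hesse a b c) ∣ A) :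
    ∀ᶠ P : CurvePoint a b c in cofinite, P.evalAffine A = 0 := by
  obtain ⟨U, rfl⟩ := hA
  filter_upwards [eventually_affine habc] with P hP
  rw [map_mul, evalAffine_affineCubic habc hP, zero_mul]

theorem eventually_ne_zero (habc : a * b * c ≠ 0)
    (hdeg : (3 * a * b * c) ^ 3 ≠ (a ^ 3 + b ^ 3 + c ^ 3) ^ 3) {A : k[X][X]}
    (hA : ¬ affineCubic (hesse a b c) ∣ A) :
    ∀ᶠ P : CurvePoint a b c in cofinite, P.evalAffine A ≠ 0 := by
  obtain ⟨q, H, U, hq, h⟩ := exists_eliminant (hesse_cube_ne habc hdeg) hA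
  have h0 : ∀ᶠ P : CurvePoint a b c in cofinite, q.eval (P.1 0) ≠ 0 := by
    refine (finite_zeros habc hq).subset fun P hP => ?_
    simpa using hP
  filter_upwards [eventually_affine habc, h0] with P hP hP' hA'
  apply hP'
  have := congrArg P.evalAffine h
  rw [map_add, map_mul, map_mul, hA', evalAffine_affineCubic habc hP] at this
  simpa [evalAffine] using this

/-- Functions on the curve that agree cofinitely with a rational function. -/
def IsRational (f : CurvePoint a b c → k) : Prop :=
  ∃ A B : k[X][X], ¬ affineCubic (hesse a b c) ∣ B ∧
    ∀ᶠ P in cofinite, P.evalAffine B * f P = P.evalAffine A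

theorem not_affineCubic_dvd {t : k} {A : k[X][X]} (h0 : A ≠ 0) (h : A.natDegree < 3) :
    ¬ affineCubic t ∣ A :=
  (affineCubic_monic t).not_dvd_of_natDegree_lt h0 (by rwa [affineCubic_natDegree])

namespace IsRational

variable {f f' : CurvePoint a b c → k}

theorem congr (hf : IsRational f) (h : f =ᶠ[cofinite] f') : IsRational f' := by
  obtain ⟨A, B, hB, hAB⟩ := hf
  refine ⟨A, B, hB, ?_⟩
  filter_upwards [hAB, h] with P h1 h2
  rw [← h2, h1]

theorem of_evalAffine (A : k[X][X]) : IsRational fun P : CurvePoint a b c => P.evalAffine A :=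
  ⟨A, 1, not_affineCubic_dvd one_ne_zero (by simp), Eventually.of_forall fun P => by simp⟩

theorem const (r : k) : IsRational fun _ : CurvePoint a b c => r := by
  simpa [evalAffine] using of_evalAffine (a := a) (b := b) (c := c) (C (C r))

theorem eventually_zero_or_ne_zero (habc : a * b * c ≠ 0)
    (hdeg : (3 * a * b * c) ^ 3 ≠ (a ^ 3 + b ^ 3 + c ^ 3) ^ 3) (hf : IsRational f) :
    (∀ᶠ P in cofinite, f P = 0) ∨ ∀ᶠ P in cofinite, f P ≠ 0 := by
  obtain ⟨A, B, hB, hAB⟩ := hf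
  by_cases hA : affineCubic (hesse a b c) ∣ A
  · left
    filter_upwards [hAB, eventually_eq_zero habc hA, eventually_ne_zero habc hdeg hB] with P h h1 h2
    rw [h1] at h
    exact (mul_eq_zero.1 h).resolve_left h2
  · right
    filter_upwards [hAB, eventually_ne_zero habc hdeg hA] with P h h1 h2
    rw [h2, mul_zero] at h
    exact h1 h.symm

theorem add (habc : a * b * c ≠ 0)
    (hdeg : (3 * a * b * c) ^ 3 ≠ (a ^ 3 + b ^ 3 + c ^ 3) ^ 3) (hf : IsRational f)
    (hf' : IsRational f') : IsRational fun P => f P + f' P := by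
  obtain ⟨A, B, hB, hAB⟩ := hf
  obtain ⟨A', B', hB', hAB'⟩ := hf'
  refine ⟨A * B' + A' * B, B * B',
    (affineCubic_irreducible (hesse_cube_ne habc hdeg)).prime.not_dvd_mul hB hB', ?_⟩
  filter_upwards [hAB, hAB'] with P h h'
  simp only [map_add, map_mul, ← h, ← h']
  ring

theorem mul (habc : a * b * c ≠ 0)
    (hdeg : (3 * a * b * c) ^ 3 ≠ (a ^ 3 + b ^ 3 + c ^ 3) ^ 3) (hf : IsRational f)
    (hf' : IsRational f') : IsRational fun P => f P * f' P := by
  obtain ⟨A, B, hB, hAB⟩ := hf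
  obtain ⟨A', B', hB', hAB'⟩ := hf'
  refine ⟨A * A', B * B',
    (affineCubic_irreducible (hesse_cube_ne habc hdeg)).prime.not_dvd_mul hB hB', ?_⟩
  filter_upwards [hAB, hAB'] with P h h'
  simp only [map_mul, ← h, ← h']
  ring

theorem inv (habc : a * b * c ≠ 0) (hf : IsRational f) (h0 : ∀ᶠ P in cofinite, f P ≠ 0) :
    IsRational fun P => (f P)⁻¹ := by
  obtain ⟨A, B, hB, hAB⟩ := hf
  by_cases hA : affineCubic (hesse a b c) ∣ A
  · have hz : ∀ᶠ P : CurvePoint a b c in cofinite, P.evalAffine B = 0 := by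
      filter_upwards [hAB, eventually_eq_zero habc hA, h0] with P h h1 h2
      rw [h1] at h
      exact (mul_eq_zero.1 h).resolve_right h2
    refine ⟨0, B, hB, ?_⟩
    filter_upwards [hz] with P h
    rw [h, zero_mul, map_zero]
  · refine ⟨B, A, hA, ?_⟩
    filter_upwards [hAB, h0] with P h h1
    rw [← h, mul_inv_cancel_right₀ h1]

theorem comp (habc : a * b * c ≠ 0)
    (hdeg : (3 * a * b * c) ^ 3 ≠ (a ^ 3 + b ^ 3 + c ^ 3) ^ 3)
    {σ : CurvePoint a b c ≃ CurvePoint a b c} (h0 : IsRational fun P => (σ P).1 0)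
    (h1 : IsRational fun P => (σ P).1 1) (hf : IsRational f) : IsRational fun P => f (σ P) := by
  have hpoly₁ : ∀ q : k[X], IsRational fun P => q.eval ((σ P).1 0) := by
    intro q
    induction q using Polynomial.induction_on' with
    | add p q hp hq => simpa only [eval_add] using hp.add habc hdeg hq
    | monomial n r =>
      induction n with
      | zero => simpa using const r
      | succ n ih =>
        simp only [eval_monomial, pow_succ, ← mul_assoc] at ih ⊢
        exact ih.mul habc hdeg h0
  have hpoly : ∀ A : k[X][X], IsRational fun P => (σ P).evalAffine A := by
    intro A
    induction A using Polynomial.induction_on' with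
    | add p q hp hq => simpa only [map_add] using hp.add habc hdeg hq
    | monomial n q =>
      induction n with
      | zero => simpa [evalAffine] using hpoly₁ q
      | succ n ih =>
        simp only [← monomial_mul_X, map_mul]
        refine ih.mul habc hdeg ?_
        simpa [evalAffine] using h1
  obtain ⟨A, B, hB, hAB⟩ := hf
  have hne := σ.injective.tendsto_cofinite.eventually (eventually_ne_zero habc hdeg hB)
  refine (((hpoly B).inv habc hne).mul habc hdeg (hpoly A)).congr ?_
  filter_upwards [hne, σ.injective.tendsto_cofinite.eventually hAB] with P h h'
  rw [← h', inv_mul_cancel_left₀ h]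

end IsRational

end CurvePoint

end CurveFunctions

section CurveFunctions

open Polynomial Filter
open scoped Matrix

variable {k : Type u} [Field k] {a b c : k}

/-- The cross product of the first two rows of the successor relation. -/
def successorVec (a b c : k) (p : Fin 3 → k) : Fin 3 → k :=
  ![b ^ 2 * (p 0 * p 2) - a * c * p 1 ^ 2, a ^ 2 * (p 1 * p 2) - b * c * p 0 ^ 2,
    c ^ 2 * (p 0 * p 1) - a * b * p 2 ^ 2]

theorem Successor.successorVec_mul {p q : Fin 3 → k} (h : Successor a b c p q) (i : Fin 3) :
    successorVec a b c p 2 * q i = successorVec a b c p i * q 2 := by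
  obtain ⟨h₁, h₂, -⟩ := successor_iff.1 h
  fin_cases i <;> simp only [successorVec, Matrix.cons_val, Fin.zero_eta, Fin.mk_one,
      Fin.reduceFinMk]
  · linear_combination c * p 1 * h₁ - b * p 2 * h₂
  · linear_combination c * p 0 * h₂ - a * p 2 * h₁

theorem successorVec_swap_two (p : Fin 3 → k) :
    successorVec b a c p 2 = successorVec a b c p 2 := by
  simp only [successorVec, Matrix.cons_val]
  ring

/-- The multilinear form attached to the canonical cubic element. -/
def cubicTrilinear (a b c : k) (p q r : Fin 3 → k) : k :=
  c * (c ^ 3 - b ^ 3) * (p 1 * q 1 * r 1) + b * (c ^ 3 - a ^ 3) * (p 1 * q 0 * r 2)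
    + a * (b ^ 3 - c ^ 3) * (p 0 * q 1 * r 2) + c * (a ^ 3 - c ^ 3) * (p 0 * q 0 * r 0)

theorem cubicTrilinear_eq_zero {p q r : Fin 3 → k} (hpq : Successor a b c p q)
    (hqr : Successor a b c q r) (hq : cubicForm a b c q = 0)
    (hD : successorVec a b c q 2 ≠ 0) : cubicTrilinear a b c p q r = 0 := by
  obtain ⟨e, he⟩ : ∃ e : k, ∀ i, p i = e * successorVec b a c q i :=
    ⟨(successorVec b a c q 2)⁻¹ * p 2, fun i => by
      rw [mul_assoc, mul_comm (p 2), ← hpq.symm.successorVec_mul i,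
        inv_mul_cancel_left₀ (by rwa [successorVec_swap_two])]⟩
  obtain ⟨e', he'⟩ : ∃ e : k, ∀ i, r i = e * successorVec a b c q i :=
    ⟨(successorVec a b c q 2)⁻¹ * r 2, fun i => by
      rw [mul_assoc, mul_comm (r 2), ← hqr.successorVec_mul i, inv_mul_cancel_left₀ hD]⟩
  have key : cubicTrilinear a b c (successorVec b a c q) q (successorVec a b c q) = 0 := by
    rw [cubicForm] at hq
    simp only [cubicTrilinear, successorVec, Matrix.cons_val]
    linear_combination c ^ 2 * (b ^ 3 - a ^ 3) * q 0 * q 1 * hq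
  have : cubicTrilinear a b c p q r = e * e' *
      cubicTrilinear a b c (successorVec b a c q) q (successorVec a b c q) := by
    simp only [cubicTrilinear, he, he']
    ring
  rw [this, key, mul_zero]

namespace CurvePoint

theorem eventually_successorVec_ne_zero (habc : a * b * c ≠ 0)
    (hdeg : (3 * a * b * c) ^ 3 ≠ (a ^ 3 + b ^ 3 + c ^ 3) ^ 3) :
    ∀ᶠ P : CurvePoint a b c in cofinite, successorVec a b c P.1 2 ≠ 0 := by
  have hc : c ≠ 0 := right_ne_zero_of_mul habc
  let A : k[X][X] := C (C (c ^ 2) * X) * X + C (C (-(a * b)))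
  have hA0 : A ≠ 0 := fun h => by
    have := congrArg (fun p => (p.coeff 0).coeff 0) h
    simp only [A, coeff_add, coeff_C_mul, coeff_X_zero, coeff_C_zero, coeff_zero, mul_zero,
        zero_add] at this
    exact left_ne_zero_of_mul habc (neg_eq_zero.1 this)
  have hA : A.natDegree < 3 := by
    refine lt_of_le_of_lt (b := 1) ?_ (by norm_num)
    unfold A
    compute_degree
  filter_upwards [eventually_affine habc, eventually_ne_zero habc hdeg
    (not_affineCubic_dvd hA0 hA)] with P hP h h0
  apply h
  simp only [successorVec, Matrix.cons_val, hP] at h0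
  simp only [A, evalAffine, coe_evalEvalRingHom, evalEval, eval_add, eval_mul, eval_X, eval_C]
  linear_combination h0

variable {σ : CurvePoint a b c ≃ CurvePoint a b c}

theorem eventually_cubicTrilinear (habc : a * b * c ≠ 0)
    (hdeg : (3 * a * b * c) ^ 3 ≠ (a ^ 3 + b ^ 3 + c ^ 3) ^ 3)
    (hσ : ∀ P, Successor a b c P.1 (σ P).1) :
    ∀ᶠ P : CurvePoint a b c in cofinite, cubicTrilinear a b c P.1 (σ P).1 (σ (σ P)).1 = 0 := by
  filter_upwards [σ.injective.tendsto_cofinite.eventually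
    (eventually_successorVec_ne_zero habc hdeg)] with P hP
  exact cubicTrilinear_eq_zero (hσ P) (hσ _) (σ P).2.1 hP

theorem IsRational.coord (habc : a * b * c ≠ 0) (i : Fin 3) :
    IsRational fun P : CurvePoint a b c => P.1 i := by
  fin_cases i
  · simpa [evalAffine] using of_evalAffine (a := a) (b := b) (c := c) (C X)
  · simpa [evalAffine] using of_evalAffine (a := a) (b := b) (c := c) X
  · refine (const 1).congr ?_
    filter_upwards [eventually_affine habc] with P hP using hP.symm

theorem IsRational.successorVec (habc : a * b * c ≠ 0)
    (hdeg : (3 * a * b * c) ^ 3 ≠ (a ^ 3 + b ^ 3 + c ^ 3) ^ 3) (i : Fin 3) :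
    IsRational fun P : CurvePoint a b c => successorVec a b c P.1 i := by
  have h2 : ∀ (r s : k) (i j l m : Fin 3), IsRational fun P : CurvePoint a b c =>
      r * (P.1 i * P.1 j) - s * (P.1 l * P.1 m) := fun r s i j l m => by
    have := (((const r).mul habc hdeg ((coord habc i).mul habc hdeg (coord habc j))).add habc hdeg
      ((const (-s)).mul habc hdeg ((coord habc l).mul habc hdeg (coord habc m))))
    simpa only [neg_mul, ← sub_eq_add_neg] using this
  fin_cases i
  · exact (h2 (b ^ 2) (a * c) 0 2 1 1).congr (.of_forall fun P => by
      simp only [_root_.successorVec, Matrix.cons_val, Fin.zero_eta]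
      ring)
  · exact (h2 (a ^ 2) (b * c) 1 2 0 0).congr (.of_forall fun P => by
      simp only [_root_.successorVec, Matrix.cons_val, Fin.mk_one]
      ring)
  · exact (h2 (c ^ 2) (a * b) 0 1 2 2).congr (.of_forall fun P => by
      simp only [_root_.successorVec, Matrix.cons_val, Fin.reduceFinMk]
      ring)

theorem IsRational.comp_successor (habc : a * b * c ≠ 0)
    (hdeg : (3 * a * b * c) ^ 3 ≠ (a ^ 3 + b ^ 3 + c ^ 3) ^ 3)
    (hσ : ∀ P, Successor a b c P.1 (σ P).1) {f : CurvePoint a b c → k} (hf : IsRational f) :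
    IsRational fun P => f (σ P) := by
  have hcoord : ∀ i, IsRational fun P => (σ P).1 i := by
    intro i
    have hne := eventually_successorVec_ne_zero habc hdeg
    refine (((IsRational.successorVec habc hdeg 2).inv habc hne).mul habc hdeg
      (IsRational.successorVec habc hdeg i)).congr ?_
    filter_upwards [hne,
        σ.injective.tendsto_cofinite.eventually (eventually_affine habc)] with P h h'
    have := (hσ P).successorVec_mul i
    rw [h', mul_one] at this
    rw [← this, inv_mul_cancel_left₀ h]
  exact .comp habc hdeg (hcoord 0) (hcoord 1) hf

/-- A general line of the pencil `x = l z` meets the curve in three distinct points avoiding a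
given finite set, and vanishes only finitely often. -/
theorem exists_line [IsAlgClosed k] [CharZero k] (habc : a * b * c ≠ 0) {T : Set (CurvePoint a b c)}
    (hT : T.Finite) : ∃ (α : Fin 3 → k) (q : Fin 3 → CurvePoint a b c), Function.Injective q ∧
      (∀ i, q i ∉ T) ∧ (∀ i, α ⬝ᵥ (q i).1 = 0) ∧
      ∀ᶠ P : CurvePoint a b c in cofinite, α ⬝ᵥ P.1 ≠ 0 := by
  classical
  let t := hesse a b c
  let D : k[X] := C 4 * (C (-t) * X) ^ 3 + C 27 * (X ^ 3 + 1) ^ 2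
  have hD : D ≠ 0 := fun h => by
    have := congrArg (eval 0) h
    simp [D] at this
  obtain ⟨l, hl⟩ := ((hT.image fun P => P.1 0).union D.roots.toFinset.finite_toSet).exists_notMem
  have hlT : ∀ P : CurvePoint a b c, P.1 0 = l → P ∉ T := fun P hP hPT => hl (Or.inl ⟨P, hPT, hP⟩)
  have hlD : 4 * (-t * l) ^ 3 + 27 * (l ^ 3 + 1) ^ 2 ≠ 0 := fun h => hl (Or.inr (by
    rw [Finset.mem_coe, Multiset.mem_toFinset, mem_roots hD, IsRoot.def]
    simpa [D] using h))
  let p : k[X] := X ^ 3 + C (-t * l) * X + C (l ^ 3 + 1)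
  have hp : p.natDegree = 3 := by
    unfold p
    compute_degree!
  have hp0 : p ≠ 0 := fun h => by simp [h] at hp
  have hsep : p.Separable := by
    have hder : derivative p = C 3 * X ^ 2 + C (-t * l) := by
      simp only [p, derivative_add, derivative_X_pow_succ, derivative_C_mul, derivative_C,
          derivative_X]
      have h3 : (C 3 : k[X]) = C 2 + C 1 := by rw [← C_add]; norm_num
      rw [h3]
      simp only [map_add, Nat.cast_ofNat]
      ring
    refine ⟨C (4 * (-t * l) ^ 3 + 27 * (l ^ 3 + 1) ^ 2)⁻¹ *
      (C (-18 * (-t * l)) * X + C (27 * (l ^ 3 + 1))),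
      C (4 * (-t * l) ^ 3 + 27 * (l ^ 3 + 1) ^ 2)⁻¹ *
      (C (6 * (-t * l)) * X ^ 2 + C (-9 * (l ^ 3 + 1)) * X + C (4 * (-t * l) ^ 2)), ?_⟩
    have h1 : C (4 * (-t * l) ^ 3 + 27 * (l ^ 3 + 1) ^ 2)⁻¹ *
        C (4 * (-t * l) ^ 3 + 27 * (l ^ 3 + 1) ^ 2) = (1 : k[X]) := by
      rw [← C_mul, inv_mul_cancel₀ hlD, C_1]
    rw [hder, ← h1]
    generalize C (4 * (-t * l) ^ 3 + 27 * (l ^ 3 + 1) ^ 2)⁻¹ = e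
    simp only [p, map_add, map_mul, map_pow, map_neg, map_one, map_ofNat]
    ring
  have hcard : p.roots.toFinset.card = 3 := by
    rw [Multiset.toFinset_card_of_nodup (nodup_roots hsep), ← hp]
    exact splits_iff_card_roots.1 (IsAlgClosed.splits p)
  let e := p.roots.toFinset.equivFinOfCardEq hcard
  have hroot : ∀ i, (e.symm i : k) ^ 3 + -t * l * e.symm i + (l ^ 3 + 1) = 0 := fun i => by
    have := (mem_roots hp0).1 (Multiset.mem_toFinset.1 (e.symm i).2)
    simpa [p] using this
  have ht : a ^ 3 + b ^ 3 + c ^ 3 = t * (a * b * c) := (div_mul_cancel₀ _ habc).symm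
  refine ⟨![1, 0, -l], fun i => ⟨![l, e.symm i, 1], ?_, Or.inl rfl⟩, ?_, fun i => hlT _ rfl,
      fun i => ?_, ?_⟩
  · simp only [cubicForm, Matrix.cons_val, ht]
    linear_combination -(a * b * c) * hroot i
  · intro i j hij
    have := congrFun (congrArg Subtype.val hij) 1
    exact e.symm.injective (Subtype.ext this)
  · simp [dotProduct, Fin.sum_univ_three]
  · have h0 : ∀ᶠ P : CurvePoint a b c in cofinite, (X - C l).eval (P.1 0) ≠ 0 := by
      refine (finite_zeros habc (X_sub_C_ne_zero l)).subset fun P hP => ?_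
      simpa using hP
    filter_upwards [h0, eventually_affine habc] with P h h'
    simpa [dotProduct, Fin.sum_univ_three, h', ← sub_eq_add_neg] using h

end CurvePoint

end CurveFunctions

section CurveRep

open Filter
open scoped Matrix

variable {k S : Type u} [Field k] [Ring S] [Algebra k S] {a b c : k} {v : Fin 3 → S}

/-- A representation of the algebra on functions on the curve, in which the generators act as
coordinates twisted by the successor automorphism. -/
structure CurveRep (a b c : k) (v : Fin 3 → S) where
  σ : CurvePoint a b c ≃ CurvePoint a b c
  successor : ∀ P, Successor a b c P.1 (σ P).1
  hom : S →ₐ[k] Module.End k (CurvePoint a b c → k)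
  hom_gen : ∀ i f P, hom (v i) f P = P.1 i * f (σ P)

theorem IsSklyanin.nonempty_curveRep (habc : a * b * c ≠ 0)
    (hdeg : (3 * a * b * c) ^ 3 ≠ (a ^ 3 + b ^ 3 + c ^ 3) ^ 3) (h : IsSklyanin a b c v) :
    Nonempty (CurveRep a b c v) := by
  obtain ⟨σ, hσ⟩ := CurvePoint.exists_equiv habc hdeg
  let w : Fin 3 → Module.End k (CurvePoint a b c → k) := fun i =>
    (LinearMap.pi fun P => P.1 i • LinearMap.proj (σ P))
  have hw : ∀ i f P, w i f P = P.1 i * f (σ P) := fun i f P => rfl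
  have key : ∀ a₁ a₂ a₃ (i₁ j₁ i₂ j₂ i₃ j₃ : Fin 3), (∀ P : CurvePoint a b c,
      a₁ * (P.1 i₁ * (σ P).1 j₁) + a₂ * (P.1 i₂ * (σ P).1 j₂) + a₃ * (P.1 i₃ * (σ P).1 j₃) = 0) →
      a₁ • (w i₁ * w j₁) + a₂ • (w i₂ * w j₂) + a₃ • (w i₃ * w j₃) = 0 := by
    intro a₁ a₂ a₃ i₁ j₁ i₂ j₂ i₃ j₃ h
    ext1 f
    funext P
    simp only [LinearMap.add_apply, LinearMap.smul_apply, Module.End.mul_apply, Pi.add_apply,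
      Pi.smul_apply, hw, LinearMap.zero_apply, Pi.zero_apply, smul_eq_mul]
    linear_combination f (σ (σ P)) * h P
  have htriple : SklyaninTriple a b c (w 0) (w 1) (w 2) := by
    refine ⟨key a b c 1 2 2 1 0 0 fun P => ?_, key a b c 2 0 0 2 1 1 fun P => ?_,
      key a b c 0 1 1 0 2 2 fun P => ?_⟩
    · linear_combination (successor_iff.1 (hσ P)).1
    · linear_combination (successor_iff.1 (hσ P)).2.1
    · linear_combination (successor_iff.1 (hσ P)).2.2
  obtain ⟨φ, hφ⟩ := h.lift w htriple
  exact ⟨σ, hσ, φ, fun i f P => by rw [hφ, hw]⟩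

namespace CurveRep

variable (ρ : CurveRep a b c v)

/-- The function on the curve attached to an element of the algebra. -/
def eval : S →ₗ[k] CurvePoint a b c → k := ρ.hom.toLinearMap.flip 1

theorem eval_apply (s : S) : ρ.eval s = ρ.hom s 1 := rfl

theorem eval_gen (i : Fin 3) (P : CurvePoint a b c) : ρ.eval (v i) P = P.1 i := by
  rw [eval_apply, ρ.hom_gen, Pi.one_apply, mul_one]

theorem eval_one (P : CurvePoint a b c) : ρ.eval 1 P = 1 := by
  rw [eval_apply, map_one ρ.hom]
  rfl

theorem hom_apply_of_mem {u : S} (hu : u ∈ genSpan k v) (f : CurvePoint a b c → k)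
    (P : CurvePoint a b c) : ρ.hom u f P = ρ.eval u P * f (ρ.σ P) := by
  induction hu using Submodule.span_induction with
  | mem x hx =>
    obtain ⟨i, rfl⟩ := hx
    rw [ρ.hom_gen, eval_gen]
  | zero => simp
  | add x y _ _ hx hy => simp only [map_add, LinearMap.add_apply, Pi.add_apply, hx, hy, add_mul]
  | smul r x _ hx => simp only [map_smul, LinearMap.smul_apply, Pi.smul_apply, hx, smul_mul_assoc]

theorem hom_apply_of_mem_pow {m : ℕ} {s : S} (hs : s ∈ genSpan k v ^ m)
    (f : CurvePoint a b c → k) (P : CurvePoint a b c) :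
    ρ.hom s f P = ρ.eval s P * f (ρ.σ^[m] P) := by
  induction m generalizing s f P with
  | zero =>
    rw [pow_zero, Submodule.mem_one] at hs
    obtain ⟨r, rfl⟩ := hs
    rw [eval_apply, AlgHom.commutes, Module.algebraMap_end_apply, Module.algebraMap_end_apply]
    simp
  | succ m ih =>
    rw [pow_succ'] at hs
    induction hs using Submodule.mul_induction_on' with
    | mem_mul_mem x hx y hy =>
      rw [eval_apply, map_mul, Module.End.mul_apply, Module.End.mul_apply, ρ.hom_apply_of_mem hx,
        ρ.hom_apply_of_mem hx, ih hy f, ih hy 1, Function.iterate_succ_apply]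
      simp only [Pi.one_apply, mul_one, mul_assoc]
    | add x _ y _ hx hy => simp only [map_add, LinearMap.add_apply, Pi.add_apply, hx, hy, add_mul]

theorem eval_mul {m : ℕ} {s : S} (hs : s ∈ genSpan k v ^ m) (t : S) (P : CurvePoint a b c) :
    ρ.eval (s * t) P = ρ.eval s P * ρ.eval t (ρ.σ^[m] P) := by
  rw [eval_apply, map_mul, Module.End.mul_apply, ρ.hom_apply_of_mem_pow hs, ← eval_apply]

theorem eval_mul_gen {u : S} (hu : u ∈ genSpan k v) (t : S) (P : CurvePoint a b c) :
    ρ.eval (u * t) P = ρ.eval u P * ρ.eval t (ρ.σ P) := by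
  rw [← pow_one (genSpan k v)] at hu
  exact ρ.eval_mul hu t P

theorem exists_eval_eq (α : Fin 3 → k) : ∃ u ∈ genSpan k v, ∀ P, ρ.eval u P = α ⬝ᵥ P.1 :=
  ⟨∑ i, α i • v i, Submodule.sum_mem _ fun i _ => Submodule.smul_mem _ _ (gen_mem v i), fun P => by
    simp only [map_sum, map_smul, Finset.sum_apply, Pi.smul_apply, eval_gen, dotProduct,
        smul_eq_mul]⟩

theorem eval_cubic (P : CurvePoint a b c) :
    ρ.eval (sklyaninCubic a b c (v 0) (v 1) (v 2)) P
      = cubicTrilinear a b c P.1 (ρ.σ P).1 (ρ.σ (ρ.σ P)).1 := by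
  simp only [sklyaninCubic, cubicTrilinear, map_add, map_smul, Pi.add_apply, Pi.smul_apply,
      mul_assoc,
    ρ.eval_mul_gen (gen_mem v _), eval_gen, smul_eq_mul]

theorem eval_isRational (habc : a * b * c ≠ 0)
    (hdeg : (3 * a * b * c) ^ 3 ≠ (a ^ 3 + b ^ 3 + c ^ 3) ^ 3) {m : ℕ} {s : S}
    (hs : s ∈ genSpan k v ^ m) : CurvePoint.IsRational (ρ.eval s) := by
  have hgen : ∀ u ∈ genSpan k v, CurvePoint.IsRational (ρ.eval u) := by
    intro u hu
    induction hu using Submodule.span_induction with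
    | mem x hx =>
      obtain ⟨i, rfl⟩ := hx
      exact (CurvePoint.IsRational.coord habc i).congr (.of_forall fun P => (ρ.eval_gen i P).symm)
    | zero => exact (CurvePoint.IsRational.const 0).congr (.of_forall fun P => by simp)
    | add x y _ _ hx hy => exact (hx.add habc hdeg hy).congr (.of_forall fun P => by simp)
    | smul r x _ hx =>
      exact ((CurvePoint.IsRational.const r).mul habc hdeg hx).congr (.of_forall fun P => by simp)
  induction m generalizing s with
  | zero =>
    rw [pow_zero, Submodule.mem_one] at hs
    obtain ⟨r, rfl⟩ := hs
    refine (CurvePoint.IsRational.const r).congr (.of_forall fun P => ?_)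
    rw [Algebra.algebraMap_eq_smul_one, map_smul, Pi.smul_apply, eval_one, smul_eq_mul, mul_one]
  | succ m ih =>
    rw [pow_succ'] at hs
    induction hs using Submodule.mul_induction_on' with
    | mem_mul_mem x hx y hy =>
      exact ((hgen x hx).mul habc hdeg ((ih hy).comp_successor habc hdeg ρ.successor)).congr
        (.of_forall fun P => (ρ.eval_mul_gen hx y P).symm)
    | add x _ y _ hx hy => exact (hx.add habc hdeg hy).congr (.of_forall fun P => by simp)

/-- The degree `n` elements whose function vanishes cofinitely. -/
def vanishing (n : ℕ) : Submodule k S where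
  carrier := {s | s ∈ genSpan k v ^ n ∧ ∀ᶠ P in cofinite, ρ.eval s P = 0}
  zero_mem' := ⟨zero_mem _, .of_forall fun P => by simp⟩
  add_mem' := by
    rintro s t ⟨hs, hs'⟩ ⟨ht, ht'⟩
    refine ⟨add_mem hs ht, ?_⟩
    filter_upwards [hs', ht'] with P h h'
    rw [map_add, Pi.add_apply, h, h', add_zero]
  smul_mem' := by
    rintro r s ⟨hs, hs'⟩
    refine ⟨Submodule.smul_mem _ r hs, ?_⟩
    filter_upwards [hs'] with P h
    rw [map_smul, Pi.smul_apply, h, smul_zero]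

theorem vanishing_le (n : ℕ) : ρ.vanishing n ≤ genSpan k v ^ n := fun _ hs => hs.1

theorem eventually_ne_of_notMem_vanishing (habc : a * b * c ≠ 0)
    (hdeg : (3 * a * b * c) ^ 3 ≠ (a ^ 3 + b ^ 3 + c ^ 3) ^ 3) {n : ℕ} {s : S}
    (hs : s ∈ genSpan k v ^ n) (h : s ∉ ρ.vanishing n) : ∀ᶠ P in cofinite, ρ.eval s P ≠ 0 :=
  ((ρ.eval_isRational habc hdeg hs).eventually_zero_or_ne_zero habc hdeg).resolve_left
    fun h' => h ⟨hs, h'⟩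

theorem tendsto_iterate (m : ℕ) : Tendsto ρ.σ^[m] cofinite cofinite :=
  (ρ.σ.injective.iterate m).tendsto_cofinite

theorem mul_mem_vanishing {m n : ℕ} {s t : S} (hs : s ∈ genSpan k v ^ m) (ht : t ∈ ρ.vanishing n) :
    s * t ∈ ρ.vanishing (m + n) := by
  refine ⟨pow_add (genSpan k v) m n ▸ Submodule.mul_mem_mul hs ht.1, ?_⟩
  filter_upwards [(ρ.tendsto_iterate m).eventually ht.2] with P h
  rw [ρ.eval_mul hs, h, mul_zero]

theorem vanishing_mul_mem {m n : ℕ} {s t : S} (hs : s ∈ ρ.vanishing m) (ht : t ∈ genSpan k v ^ n) :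
    s * t ∈ ρ.vanishing (m + n) := by
  refine ⟨pow_add (genSpan k v) m n ▸ Submodule.mul_mem_mul hs.1 ht, ?_⟩
  filter_upwards [hs.2] with P h
  rw [ρ.eval_mul hs.1, h, zero_mul]

theorem mem_vanishing_or_mem_vanishing [IsAlgClosed k] [CharZero k] (habc : a * b * c ≠ 0)
    (hdeg : (3 * a * b * c) ^ 3 ≠ (a ^ 3 + b ^ 3 + c ^ 3) ^ 3)
    [Infinite (CurvePoint a b c)] {m n : ℕ} {s t : S}
    (hs : s ∈ genSpan k v ^ m) (ht : t ∈ genSpan k v ^ n)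
    (hst : ∀ᶠ P in cofinite, ρ.eval (s * t) P = 0) : s ∈ ρ.vanishing m ∨ t ∈ ρ.vanishing n := by
  by_contra! h
  have h1 := ρ.eventually_ne_of_notMem_vanishing habc hdeg hs h.1
  have h2 := (ρ.tendsto_iterate m).eventually (ρ.eventually_ne_of_notMem_vanishing habc hdeg ht h.2)
  obtain ⟨P, h, h', h''⟩ := (hst.and (h1.and h2)).exists
  rw [ρ.eval_mul hs] at h
  exact (mul_ne_zero h' h'') h

theorem _root_.sklyaninCubic_mem : sklyaninCubic a b c (v 0) (v 1) (v 2) ∈ genSpan k v ^ 3 := by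
  have h : ∀ i j l, v i * v j * v l ∈ genSpan k v ^ 3 := fun i j l => by
    rw [pow_three']
    exact Submodule.mul_mem_mul (Submodule.mul_mem_mul (gen_mem v i) (gen_mem v j)) (gen_mem v l)
  exact add_mem (add_mem (add_mem (Submodule.smul_mem _ _ (h _ _ _))
    (Submodule.smul_mem _ _ (h _ _ _)))
    (Submodule.smul_mem _ _ (h _ _ _))) (Submodule.smul_mem _ _ (h _ _ _))

theorem cubicIdeal_le_vanishing (habc : a * b * c ≠ 0)
    (hdeg : (3 * a * b * c) ^ 3 ≠ (a ^ 3 + b ^ 3 + c ^ 3) ^ 3) (n : ℕ) :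
    cubicIdeal (sklyaninCubic a b c (v 0) (v 1) (v 2)) (genSpan k v) n ≤ ρ.vanishing n := by
  have hg : sklyaninCubic a b c (v 0) (v 1) (v 2) ∈ ρ.vanishing 3 := by
    refine ⟨sklyaninCubic_mem, ?_⟩
    filter_upwards [CurvePoint.eventually_cubicTrilinear habc hdeg ρ.successor] with P hP
    rw [eval_cubic, hP]
  match n with
  | 0 | 1 | 2 => exact bot_le
  | n + 3 =>
    rintro _ ⟨s, hs, rfl⟩
    rw [add_comm n]
    exact ρ.vanishing_mul_mem hg hs

instance (n : ℕ) : FiniteDimensional k (ρ.vanishing n) :=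
  Submodule.finiteDimensional_of_le (ρ.vanishing_le n)

theorem exists_exceptional (n : ℕ) : ∃ T : Set (CurvePoint a b c), T.Finite ∧
    ∀ s ∈ ρ.vanishing n, ∀ P ∉ T, ρ.eval s P = 0 := by
  obtain ⟨F, hF⟩ := (Submodule.fg_iff_finiteDimensional _).2
    (inferInstance : FiniteDimensional k (ρ.vanishing n))
  refine ⟨⋃ s ∈ F, {P | ρ.eval s P ≠ 0}, F.finite_toSet.biUnion fun s hs => ?_, fun s hs P hP => ?_⟩
  · exact (hF ▸ Submodule.subset_span hs : s ∈ ρ.vanishing n).2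
  · rw [← hF] at hs
    induction hs using Submodule.span_induction with
    | mem x hx => simpa using fun h => hP (Set.mem_biUnion hx h)
    | zero => simp
    | add x y _ _ hx hy => rw [map_add, Pi.add_apply, hx, hy, add_zero]
    | smul r x _ hx => rw [map_smul, Pi.smul_apply, hx, smul_zero]

theorem exists_separating (n : ℕ) (T : Finset (CurvePoint a b c)) (hT : T.card ≤ n)
    (Q : CurvePoint a b c) (hQ : Q ∉ T) :
    ∃ s ∈ genSpan k v ^ n, ρ.eval s Q ≠ 0 ∧ ∀ P ∈ T, ρ.eval s P = 0 := by
  classical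
  induction n generalizing T Q with
  | zero =>
    rw [Finset.card_eq_zero.1 (Nat.le_zero.1 hT)]
    refine ⟨1, ?_, ?_, by simp⟩
    · rw [pow_zero]
      exact Submodule.one_le.1 le_rfl
    · rw [eval_one]
      exact one_ne_zero
  | succ n ih =>
    obtain ⟨α, T', hT', hα, hαQ, hsub⟩ : ∃ (α : Fin 3 → k) (T' : Finset (CurvePoint a b c)),
        T'.card ≤ n ∧ Q ∉ T' ∧ α ⬝ᵥ Q.1 ≠ 0 ∧ ∀ P ∈ T, α ⬝ᵥ P.1 = 0 ∨ P ∈ T' := by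
      rcases T.eq_empty_or_nonempty with rfl | ⟨P, hP⟩
      · obtain ⟨α, hα⟩ := Q.exists_form_ne_zero
        exact ⟨α, ∅, by simp, by simp, hα, by simp⟩
      · have hne : P ≠ Q := fun h => hQ (h ▸ hP)
        obtain ⟨α, hα, hαQ⟩ := CurvePoint.exists_separating hne
        refine ⟨α, T.erase P, ?_, fun h => hQ (Finset.mem_of_mem_erase h), hαQ, fun P' hP' => ?_⟩
        · rw [Finset.card_erase_of_mem hP]
          omega
        · by_cases h : P' = P
          · exact Or.inl (h ▸ hα)
          · exact Or.inr (Finset.mem_erase.2 ⟨h, hP'⟩)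
    obtain ⟨u, hu, huα⟩ := ρ.exists_eval_eq α
    obtain ⟨s, hs, hsQ, hsT⟩ := ih (T'.image ρ.σ) (Finset.card_image_le.trans hT') (ρ.σ Q)
      (by simpa using hα)
    refine ⟨u * s, pow_succ' (genSpan k v) n ▸ Submodule.mul_mem_mul hu hs, ?_, fun P hP => ?_⟩
    · rw [ρ.eval_mul_gen hu, huα]
      exact mul_ne_zero hαQ hsQ
    · rw [ρ.eval_mul_gen hu, huα]
      rcases hsub P hP with h | h
      · rw [h, zero_mul]
      · rw [hsT _ (Finset.mem_image_of_mem _ h), mul_zero]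

end CurveRep

end CurveRep

section Growth

open Filter
open scoped Matrix

variable {k S : Type u} [Field k] [Ring S] [Algebra k S] {a b c : k} {v : Fin 3 → S}

theorem CurvePoint.infinite [IsAlgClosed k] [CharZero k] (habc : a * b * c ≠ 0) :
    Infinite (CurvePoint a b c) := by
  by_contra h
  have : Finite (CurvePoint a b c) := not_infinite_iff_finite.1 h
  obtain ⟨-, q, -, hq, -⟩ := exists_line habc (Set.finite_univ (α := CurvePoint a b c))
  exact hq 0 trivial

namespace CurveRep

variable (ρ : CurveRep a b c v)

/-- Simultaneous evaluation at finitely many points. -/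
def evalAt {r : ℕ} (q : Fin r → CurvePoint a b c) : S →ₗ[k] Fin r → k :=
  (LinearMap.funLeft k k q) ∘ₗ ρ.eval

theorem evalAt_apply {r : ℕ} (q : Fin r → CurvePoint a b c) (s : S) (i : Fin r) :
    ρ.evalAt q s i = ρ.eval s (q i) := rfl

theorem map_evalAt {r : ℕ} {q : Fin r → CurvePoint a b c} (hq : Function.Injective q) {n : ℕ}
    (hr : r ≤ n + 1) : (genSpan k v ^ n).map (ρ.evalAt q) = ⊤ := by
  classical
  rw [eq_top_iff, ← (Pi.basisFun k (Fin r)).span_eq, Submodule.span_le]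
  rintro _ ⟨i, rfl⟩
  obtain ⟨s, hs, hsi, hsT⟩ := ρ.exists_separating n ((Finset.univ.erase i).image q)
    (Finset.card_image_le.trans (by
      rw [Finset.card_erase_of_mem (Finset.mem_univ _)]; simpa using hr))
    (q i) (by simpa using fun j hj h => hj (hq h))
  refine ⟨(ρ.eval s (q i))⁻¹ • s, Submodule.smul_mem _ _ hs, funext fun j => ?_⟩
  rw [evalAt_apply, map_smul, Pi.smul_apply, smul_eq_mul, Pi.basisFun_apply]
  by_cases h : j = i
  · rw [h, inv_mul_cancel₀ hsi, Pi.single_eq_same]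
  · rw [hsT (q j) (Finset.mem_image_of_mem _ (Finset.mem_erase.2 ⟨h, Finset.mem_univ j⟩)), mul_zero,
      Pi.single_eq_of_ne h]

theorem finrank_inf_ker_evalAt {r : ℕ} {q : Fin r → CurvePoint a b c} (hq : Function.Injective q)
    {n : ℕ} (hr : r ≤ n + 1) :
    r + Module.finrank k (genSpan k v ^ n ⊓ LinearMap.ker (ρ.evalAt q) : Submodule k S)
      = Module.finrank k (genSpan k v ^ n : Submodule k S) := by
  rw [← finrank_map_add_finrank_inf_ker (ρ.evalAt q) (genSpan k v ^ n), ρ.map_evalAt hq hr,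
    finrank_top, Module.finrank_fin_fun]

variable {ρ} in
theorem finrank_lineIdeal [IsAlgClosed k] [CharZero k] (habc : a * b * c ≠ 0)
    (hdeg : (3 * a * b * c) ^ 3 ≠ (a ^ 3 + b ^ 3 + c ^ 3) ^ 3) {u : S} (hu : u ∈ genSpan k v)
    (hu0 : ∀ᶠ P in cofinite, ρ.eval u P ≠ 0) (n : ℕ) :
    Module.finrank k ((genSpan k v ^ n).map (LinearMap.mulLeft k u) ⊔ ρ.vanishing (n + 1) :
      Submodule k S) + Module.finrank k (ρ.vanishing n)
      = Module.finrank k (genSpan k v ^ n : Submodule k S)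
        + Module.finrank k (ρ.vanishing (n + 1)) := by
  have := CurvePoint.infinite habc
  have hker : genSpan k v ^ n ⊓ LinearMap.ker ((ρ.vanishing (n + 1)).mkQ ∘ₗ LinearMap.mulLeft k u)
      = ρ.vanishing n := by
    ext s
    rw [Submodule.mem_inf, LinearMap.mem_ker, LinearMap.comp_apply, Submodule.mkQ_apply,
      Submodule.Quotient.mk_eq_zero, LinearMap.mulLeft_apply]
    have hu1 : u ∈ genSpan k v ^ 1 := by rwa [pow_one]
    constructor
    · rintro ⟨hs, hus⟩
      refine (ρ.mem_vanishing_or_mem_vanishing habc hdeg hu1 hs hus.2).resolve_left fun h => ?_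
      obtain ⟨P, h1, h2⟩ := (hu0.and h.2).exists
      exact h1 h2
    · exact fun hs => ⟨hs.1, add_comm 1 n ▸ ρ.mul_mem_vanishing hu1 hs⟩
  have h1 := finrank_map_add_finrank_inf_ker
    ((ρ.vanishing (n + 1)).mkQ ∘ₗ LinearMap.mulLeft k u) (genSpan k v ^ n)
  rw [hker, Submodule.map_comp] at h1
  have h2 := finrank_map_mkQ_add (A := ρ.vanishing (n + 1))
    (B := (genSpan k v ^ n).map (LinearMap.mulLeft k u) ⊔ ρ.vanishing (n + 1)) le_sup_right
  rw [Submodule.map_sup, Submodule.mkQ_map_self, sup_bot_eq] at h2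
  omega

theorem lineIdeal_le {r : ℕ} {u : S} (hu : u ∈ genSpan k v) {q : Fin r → CurvePoint a b c}
    (hq : ∀ i, ρ.eval u (q i) = 0) {n : ℕ}
    (hJ : ∀ s ∈ ρ.vanishing (n + 1), ∀ i, ρ.eval s (q i) = 0) :
    (genSpan k v ^ n).map (LinearMap.mulLeft k u) ⊔ ρ.vanishing (n + 1)
      ≤ genSpan k v ^ (n + 1) ⊓ LinearMap.ker (ρ.evalAt q) := by
  refine sup_le ?_ fun s hs => ⟨hs.1, funext fun i => hJ s hs i⟩
  rintro _ ⟨s, hs, rfl⟩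
  refine ⟨pow_succ' (genSpan k v) n ▸ Submodule.mul_mem_mul hu hs, funext fun i => ?_⟩
  rw [evalAt_apply, LinearMap.mulLeft_apply, ρ.eval_mul_gen hu, hq, zero_mul]
  rfl

variable [IsAlgClosed k] [CharZero k]

/-- A linear form with three distinct zeros outside a finite set and outside the exceptional
set of a degree. -/
theorem exists_line (habc : a * b * c ≠ 0) (n : ℕ) {T : Set (CurvePoint a b c)} (hT : T.Finite) :
    ∃ u ∈ genSpan k v, ∃ q : Fin 3 → CurvePoint a b c, Function.Injective q ∧ (∀ i, q i ∉ T) ∧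
      (∀ i, ρ.eval u (q i) = 0) ∧ (∀ᶠ P in cofinite, ρ.eval u P ≠ 0) ∧
      ∀ s ∈ ρ.vanishing n, ∀ i, ρ.eval s (q i) = 0 := by
  obtain ⟨T', hT', hs⟩ := ρ.exists_exceptional n
  obtain ⟨α, q, hq, hqT, hα, hα'⟩ := CurvePoint.exists_line habc (hT.union hT')
  obtain ⟨u, hu, huα⟩ := ρ.exists_eval_eq α
  refine ⟨u, hu, q, hq, fun i h => hqT i (Or.inl h), fun i => by rw [huα, hα], ?_,
    fun s h i => hs s h _ fun h' => hqT i (Or.inr h')⟩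
  filter_upwards [hα'] with P hP
  rwa [huα]

theorem finrank_growth (habc : a * b * c ≠ 0)
    (hdeg : (3 * a * b * c) ^ 3 ≠ (a ^ 3 + b ^ 3 + c ^ 3) ^ 3) (n r : ℕ) (hr3 : r ≤ 3)
    (hr : r ≤ n + 2) :
    Module.finrank k (genSpan k v ^ n : Submodule k S) + Module.finrank k (ρ.vanishing (n + 1)) + r
      ≤ Module.finrank k (genSpan k v ^ (n + 1) : Submodule k S)
        + Module.finrank k (ρ.vanishing n) := by
  obtain ⟨u, hu, q, hq, -, hqu, hu0, hJ⟩ := ρ.exists_line habc (n + 1) Set.finite_empty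
  have h1 := finrank_lineIdeal habc hdeg hu hu0 n
  have h2 := ρ.finrank_inf_ker_evalAt (q := q ∘ Fin.castLE hr3)
    (hq.comp (Fin.castLE_injective hr3)) (n := n + 1) hr
  have h3 := Submodule.finrank_mono
    (ρ.lineIdeal_le (q := q ∘ Fin.castLE hr3) hu (fun i => hqu _) fun s hs i => hJ s hs _)
  omega

theorem vanishing_zero (habc : a * b * c ≠ 0) : ρ.vanishing 0 = ⊥ := by
  have := CurvePoint.infinite habc
  rw [eq_bot_iff]
  rintro s ⟨hs, hs'⟩
  rw [pow_zero, Submodule.mem_one] at hs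
  obtain ⟨r, rfl⟩ := hs
  obtain ⟨P, hP⟩ := hs'.exists
  rw [Algebra.algebraMap_eq_smul_one, map_smul, Pi.smul_apply, eval_one, smul_eq_mul, mul_one] at hP
  rw [hP, map_zero]
  exact zero_mem _

theorem nontrivial (ρ : CurveRep a b c v) (habc : a * b * c ≠ 0) : Nontrivial S := by
  have := CurvePoint.infinite habc
  refine nontrivial_of_ne 1 0 fun h => ?_
  have h1 := ρ.eval_one (Classical.arbitrary _)
  rw [h, map_zero] at h1
  exact zero_ne_one h1

theorem finrank_lower (habc : a * b * c ≠ 0)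
    (hdeg : (3 * a * b * c) ^ 3 ≠ (a ^ 3 + b ^ 3 + c ^ 3) ^ 3) (n : ℕ) :
    3 * (n + 1) + Module.finrank k (ρ.vanishing (n + 1))
      ≤ Module.finrank k (genSpan k v ^ (n + 1) : Submodule k S) := by
  induction n with
  | zero =>
    have h1 := ρ.finrank_growth habc hdeg 0 2 (by norm_num) (by norm_num)
    have := ρ.nontrivial habc
    rw [pow_zero, Submodule.one_eq_span, finrank_span_singleton one_ne_zero, ρ.vanishing_zero habc,
        finrank_bot] at h1
    omega
  | succ n ih =>
    have := ρ.finrank_growth habc hdeg (n + 1) 3 le_rfl (by omega)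
    omega

theorem vanishing_eq_cubicIdeal (habc : a * b * c ≠ 0)
    (hdeg : (3 * a * b * c) ^ 3 ≠ (a ^ 3 + b ^ 3 + c ^ 3) ^ 3) (h : IsSklyanin a b c v) (n : ℕ) :
    ρ.vanishing n = cubicIdeal (sklyaninCubic a b c (v 0) (v 1) (v 2)) (genSpan k v) n := by
  have hle := ρ.cubicIdeal_le_vanishing habc hdeg n
  cases n with
  | zero => rw [ρ.vanishing_zero habc, eq_comm, eq_bot_iff, ← ρ.vanishing_zero habc]; exact hle
  | succ n =>
    refine (Submodule.eq_of_le_of_finrank_le hle ?_).symm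
    obtain ⟨C, hC, hCr, hCle⟩ := h.exists_complement habc hdeg n
    have := Submodule.finiteDimensional_of_le hle
    have h1 := ρ.finrank_lower habc hdeg n
    have h2 := Submodule.finrank_mono hCle
    have h3 := Submodule.finrank_add_le_finrank_add_finrank C
      (cubicIdeal (sklyaninCubic a b c (v 0) (v 1) (v 2)) (genSpan k v) (n + 1))
    omega

theorem finrank_genSpan_pow (habc : a * b * c ≠ 0)
    (hdeg : (3 * a * b * c) ^ 3 ≠ (a ^ 3 + b ^ 3 + c ^ 3) ^ 3) (h : IsSklyanin a b c v) (n : ℕ) :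
    Module.finrank k (genSpan k v ^ (n + 1) : Submodule k S)
      = 3 * (n + 1) + Module.finrank k (ρ.vanishing (n + 1)) := by
  refine le_antisymm ?_ (ρ.finrank_lower habc hdeg n)
  obtain ⟨C, hC, hCr, hCle⟩ := h.exists_complement habc hdeg n
  rw [← ρ.vanishing_eq_cubicIdeal habc hdeg h] at hCle
  have h2 := Submodule.finrank_mono hCle
  have h3 := Submodule.finrank_add_le_finrank_add_finrank C (ρ.vanishing (n + 1))
  omega

theorem isCritical (habc : a * b * c ≠ 0)
    (hdeg : (3 * a * b * c) ^ 3 ≠ (a ^ 3 + b ^ 3 + c ^ 3) ^ 3) (h : IsSklyanin a b c v) :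
    IsCritical (genSpan k v) ρ.vanishing := by
  intro m f hf hfJ
  refine ⟨m + 1, by omega, fun n hn => ?_⟩
  obtain ⟨n, rfl⟩ : ∃ l, n = l + 1 := ⟨n - 1, by omega⟩
  have hne := (ρ.tendsto_iterate (n + 1 + 1 - m)).eventually
    (ρ.eventually_ne_of_notMem_vanishing habc hdeg hf hfJ)
  obtain ⟨u, hu, q, hq, hqT, hqu, hu0, hJ⟩ := ρ.exists_line habc (n + 1 + 1) hne
  have hqf : ∀ i, ρ.eval f (ρ.σ^[n + 1 + 1 - m] (q i)) ≠ 0 := fun i => by simpa using hqT i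
  have heq : (genSpan k v ^ (n + 1)).map (LinearMap.mulLeft k u) ⊔ ρ.vanishing (n + 1 + 1)
      = genSpan k v ^ (n + 1 + 1) ⊓ LinearMap.ker (ρ.evalAt q) := by
    refine Submodule.eq_of_le_of_finrank_le (ρ.lineIdeal_le hu hqu hJ) ?_
    have h1 := finrank_lineIdeal habc hdeg hu hu0 (n + 1)
    have h2 := ρ.finrank_inf_ker_evalAt hq (n := n + 1 + 1) (by omega)
    have h3 := ρ.finrank_genSpan_pow habc hdeg h n
    have h4 := ρ.finrank_genSpan_pow habc hdeg h (n + 1)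
    omega
  refine ⟨u, hu, fun t ht => ?_⟩
  have hsurj := ρ.map_evalAt hq (n := n + 1 + 1 - m) (by omega)
  obtain ⟨s, hs, hst⟩ : (fun i => ρ.eval t (q i) / ρ.eval f (ρ.σ^[n + 1 + 1 - m] (q i)))
      ∈ (genSpan k v ^ (n + 1 + 1 - m)).map (ρ.evalAt q) := hsurj ▸ Submodule.mem_top
  have hsf : s * f ∈ genSpan k v ^ (n + 1 + 1) := by
    have := Submodule.mul_mem_mul hs hf
    rwa [← pow_add, Nat.sub_add_cancel (by omega)] at this
  have hmem : t - s * f ∈ genSpan k v ^ (n + 1 + 1) ⊓ LinearMap.ker (ρ.evalAt q) := by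
    refine ⟨sub_mem ht hsf, funext fun i => ?_⟩
    have hi : ρ.eval s (q i) = _ := congrFun hst i
    rw [evalAt_apply, map_sub, Pi.sub_apply, ρ.eval_mul hs, hi, div_mul_cancel₀ _ (hqf i), sub_self]
    rfl
  rw [← heq] at hmem
  rw [sup_right_comm, ← sub_add_cancel t (s * f)]
  exact add_mem (Submodule.mem_sup_left hmem) (Submodule.mem_sup_right ⟨s, hs, rfl⟩)

end CurveRep

theorem IsSklyanin.isNoetherianRing [IsAlgClosed k] [CharZero k] (habc : a * b * c ≠ 0)
    (hdeg : (3 * a * b * c) ^ 3 ≠ (a ^ 3 + b ^ 3 + c ^ 3) ^ 3) (h : IsSklyanin a b c v) :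
    IsNoetherianRing S := by
  obtain ⟨ρ⟩ := h.nonempty_curveRep habc hdeg
  have hJ := ρ.vanishing_eq_cubicIdeal habc hdeg h
  refine (ρ.isCritical habc hdeg h).isNoetherianRing ρ.vanishing_le (fun n => ?_)
    sklyaninCubic_mem h.cubic_mul (fun n hn => ?_) (fun n => ?_) (iSup_genSpan_pow h.adjoin)
  · refine Submodule.mul_le.2 fun u hu s hs => ?_
    rw [← pow_one (genSpan k v)] at hu
    exact add_comm 1 n ▸ ρ.mul_mem_vanishing hu hs
  · rw [hJ]
    interval_cases n <;> rfl
  · rw [hJ]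
    exact le_rfl

end Growth

section Domain

open Filter
open scoped Matrix

variable {k S : Type u} [Field k] [Ring S] [Algebra k S] {a b c : k} {v : Fin 3 → S}

theorem mem_cubicIdeal_iff {g : S} {V : Submodule k S} {n : ℕ} {s : S} :
    s ∈ cubicIdeal g V n ↔ s = 0 ∨ ∃ m, n = m + 3 ∧ ∃ t ∈ V ^ m, s = g * t := by
  match n with
  | 0 | 1 | 2 => simp [cubicIdeal]
  | n + 3 =>
    constructor
    · rintro ⟨t, ht, rfl⟩
      exact Or.inr ⟨n, rfl, t, ht, rfl⟩
    · rintro (rfl | ⟨m, hm, t, ht, rfl⟩)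
      · exact zero_mem _
      · obtain rfl : n = m := by omega
        exact ⟨t, ht, rfl⟩

namespace CurveRep

variable [IsAlgClosed k] [CharZero k]

theorem mem_cubicIdeal_or_mem_cubicIdeal (ρ : CurveRep a b c v) (habc : a * b * c ≠ 0)
    (hdeg : (3 * a * b * c) ^ 3 ≠ (a ^ 3 + b ^ 3 + c ^ 3) ^ 3) (h : IsSklyanin a b c v) {m n : ℕ}
    {s t : S} (hs : s ∈ genSpan k v ^ m) (ht : t ∈ genSpan k v ^ n) (hst : s * t = 0) :
    s ∈ cubicIdeal (sklyaninCubic a b c (v 0) (v 1) (v 2)) (genSpan k v) m ∨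
      t ∈ cubicIdeal (sklyaninCubic a b c (v 0) (v 1) (v 2)) (genSpan k v) n := by
  have := CurvePoint.infinite habc
  rw [← ρ.vanishing_eq_cubicIdeal habc hdeg h, ← ρ.vanishing_eq_cubicIdeal habc hdeg h]
  exact ρ.mem_vanishing_or_mem_vanishing habc hdeg hs ht (.of_forall fun P => by
    rw [hst, map_zero, Pi.zero_apply])

theorem eq_zero_of_mul_gen (ρ : CurveRep a b c v) (habc : a * b * c ≠ 0)
    (hdeg : (3 * a * b * c) ^ 3 ≠ (a ^ 3 + b ^ 3 + c ^ 3) ^ 3) (h : IsSklyanin a b c v) {n : ℕ}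
    (hinj : ∀ m < n, ∀ s ∈ genSpan k v ^ m,
      sklyaninCubic a b c (v 0) (v 1) (v 2) * s = 0 → s = 0) {s : S}
    (hs : s ∈ genSpan k v ^ n) (h0 : ∀ i, s * v i = 0) : s = 0 := by
  induction n using Nat.strong_induction_on generalizing s with
  | _ n ih =>
  have hmem : s ∈ cubicIdeal (sklyaninCubic a b c (v 0) (v 1) (v 2)) (genSpan k v) n := by
    by_contra hcon
    have hv : ∀ i, v i = 0 := fun i => by
      have := (ρ.mem_cubicIdeal_or_mem_cubicIdeal habc hdeg h hs (n := 1)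
        ((pow_one (genSpan k v)).symm ▸ gen_mem v i) (h0 i)).resolve_left hcon
      simpa [cubicIdeal] using this
    have := CurvePoint.infinite habc
    let P : CurvePoint a b c := Classical.arbitrary _
    exact P.ne_zero (funext fun i => by rw [← ρ.eval_gen, hv, map_zero]; rfl)
  obtain rfl | ⟨m, rfl, t, ht, rfl⟩ := mem_cubicIdeal_iff.1 hmem
  · rfl
  rw [ih m (by omega) (fun l hl => hinj l (by omega)) ht fun i => ?_, mul_zero]
  refine hinj (m + 1) (by omega) _ ?_ (by rw [← mul_assoc, h0])
  rw [pow_succ]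
  exact Submodule.mul_mem_mul ht (gen_mem v i)

theorem finrank_genSpan_pow_eq (ρ : CurveRep a b c v) (habc : a * b * c ≠ 0)
    (hdeg : (3 * a * b * c) ^ 3 ≠ (a ^ 3 + b ^ 3 + c ^ 3) ^ 3) (h : IsSklyanin a b c v) {n : ℕ}
    (hinj : ∀ m, m + 3 ≤ n → ∀ s ∈ genSpan k v ^ m,
      sklyaninCubic a b c (v 0) (v 1) (v 2) * s = 0 → s = 0) :
    2 * Module.finrank k (genSpan k v ^ n : Submodule k S) = (n + 1) * (n + 2) := by
  induction n using Nat.strong_induction_on with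
  | _ n ih =>
  have hn (n : ℕ) : Module.finrank k (genSpan k v ^ (n + 1) : Submodule k S) = 3 * (n + 1) +
      Module.finrank k
        (cubicIdeal (sklyaninCubic a b c (v 0) (v 1) (v 2)) (genSpan k v) (n + 1)) := by
    rw [← ρ.vanishing_eq_cubicIdeal habc hdeg h, ρ.finrank_genSpan_pow habc hdeg h]
  match n with
  | 0 =>
    have := ρ.nontrivial habc
    rw [pow_zero, Submodule.one_eq_span, finrank_span_singleton one_ne_zero]
  | 1 | 2 => rw [hn, cubicIdeal, finrank_bot]
  | n + 3 =>
    have h1 := finrank_map_add_finrank_inf_ker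
      (LinearMap.mulLeft k (sklyaninCubic a b c (v 0) (v 1) (v 2))) (genSpan k v ^ n)
    have h2 : genSpan k v ^ n ⊓ LinearMap.ker
        (LinearMap.mulLeft k (sklyaninCubic a b c (v 0) (v 1) (v 2))) = ⊥ :=
      (Submodule.eq_bot_iff _).2 fun s hs => hinj n le_rfl s hs.1 hs.2
    rw [h2, finrank_bot, add_zero] at h1
    rw [hn, cubicIdeal, h1, mul_add, ih n (by omega) fun m hm => hinj m (by omega)]
    ring

theorem eq_zero_of_cubic_mul (ρ : CurveRep a b c v) (habc : a * b * c ≠ 0)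
    (hdeg : (3 * a * b * c) ^ 3 ≠ (a ^ 3 + b ^ 3 + c ^ 3) ^ 3) (h : IsSklyanin a b c v) {n : ℕ}
    {s : S} (hs : s ∈ genSpan k v ^ n)
    (h0 : sklyaninCubic a b c (v 0) (v 1) (v 2) * s = 0) : s = 0 := by
  induction n using Nat.strong_induction_on generalizing s with
  | _ n ih =>
  have hinj : ∀ m < n, ∀ s ∈ genSpan k v ^ m,
      sklyaninCubic a b c (v 0) (v 1) (v 2) * s = 0 → s = 0 := fun m hm s => ih m hm
  have hlow := h.finrank_lower n fun s hs h0 h1 h2 =>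
    ρ.eq_zero_of_mul_gen habc hdeg h hinj hs (Fin.forall_fin_succ.2
      ⟨h0, Fin.forall_fin_two.2 ⟨h1, h2⟩⟩)
  have e0 := ρ.finrank_genSpan_pow_eq habc hdeg h (n := n) fun m hm => hinj m (by omega)
  have e1 := ρ.finrank_genSpan_pow_eq habc hdeg h (n := n + 1) fun m hm => hinj m (by omega)
  have e2 := ρ.finrank_genSpan_pow_eq habc hdeg h (n := n + 2) fun m hm => hinj m (by omega)
  have e3 := ρ.finrank_genSpan_pow habc hdeg h (n + 2)
  rw [ρ.vanishing_eq_cubicIdeal habc hdeg h, cubicIdeal] at e3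
  have hker := finrank_map_add_finrank_inf_ker
    (LinearMap.mulLeft k (sklyaninCubic a b c (v 0) (v 1) (v 2))) (genSpan k v ^ n)
  have hzero : Module.finrank k (genSpan k v ^ n ⊓ LinearMap.ker
      (LinearMap.mulLeft k (sklyaninCubic a b c (v 0) (v 1) (v 2))) : Submodule k S) = 0 := by
    rw [show n + 2 + 1 = n + 3 from rfl] at e3
    generalize Module.finrank k (genSpan k v ^ n ⊓ LinearMap.ker
      (LinearMap.mulLeft k (sklyaninCubic a b c (v 0) (v 1) (v 2))) : Submodule k S) = z at *
    nlinarith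
  have := Submodule.finiteDimensional_of_le (S₁ := genSpan k v ^ n ⊓ LinearMap.ker
      (LinearMap.mulLeft k (sklyaninCubic a b c (v 0) (v 1) (v 2)))) inf_le_left
  have hmem : s ∈ genSpan k v ^ n ⊓ LinearMap.ker
      (LinearMap.mulLeft k (sklyaninCubic a b c (v 0) (v 1) (v 2))) := ⟨hs, h0⟩
  rw [Submodule.finrank_eq_zero.1 hzero] at hmem
  exact hmem

theorem homogeneous_eq_zero_or_eq_zero (ρ : CurveRep a b c v) (habc : a * b * c ≠ 0)
    (hdeg : (3 * a * b * c) ^ 3 ≠ (a ^ 3 + b ^ 3 + c ^ 3) ^ 3) (h : IsSklyanin a b c v) {m n : ℕ}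
    {s t : S} (hs : s ∈ genSpan k v ^ m) (ht : t ∈ genSpan k v ^ n) (hst : s * t = 0) :
    s = 0 ∨ t = 0 := by
  induction hN : m + n using Nat.strong_induction_on generalizing m n s t with
  | _ N ih =>
  rcases ρ.mem_cubicIdeal_or_mem_cubicIdeal habc hdeg h hs ht hst with hmem | hmem
  · obtain rfl | ⟨l, rfl, r, hr, rfl⟩ := mem_cubicIdeal_iff.1 hmem
    · exact Or.inl rfl
    rw [mul_assoc] at hst
    have hrt : r * t ∈ genSpan k v ^ (l + n) := by
      rw [pow_add]
      exact Submodule.mul_mem_mul hr ht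
    rcases ih (l + n) (by omega) hr ht (ρ.eq_zero_of_cubic_mul habc hdeg h hrt hst) rfl with h | h
    exacts [Or.inl (by rw [h, mul_zero]), Or.inr h]
  · obtain rfl | ⟨l, rfl, r, hr, rfl⟩ := mem_cubicIdeal_iff.1 hmem
    · exact Or.inr rfl
    rw [← mul_assoc, ← h.cubic_mul, mul_assoc] at hst
    have hrt : s * r ∈ genSpan k v ^ (m + l) := by
      rw [pow_add]
      exact Submodule.mul_mem_mul hs hr
    rcases ih (m + l) (by omega) hs hr (ρ.eq_zero_of_cubic_mul habc hdeg h hrt hst) rfl with h | h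
    exacts [Or.inl h, Or.inr (by rw [h, mul_zero])]

end CurveRep

theorem IsSklyanin.isDomain [IsAlgClosed k] [CharZero k] (habc : a * b * c ≠ 0)
    (hdeg : (3 * a * b * c) ^ 3 ≠ (a ^ 3 + b ^ 3 + c ^ 3) ^ 3) (h : IsSklyanin a b c v) :
    IsDomain S := by
  obtain ⟨ρ⟩ := h.nonempty_curveRep habc hdeg
  obtain ⟨δ, hδ⟩ := h.exists_grading
  have := ρ.nontrivial habc
  have := hδ.noZeroDivisors h.adjoin fun m n s hs t ht hst =>
    ρ.homogeneous_eq_zero_or_eq_zero habc hdeg h hs ht hst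
  exact NoZeroDivisors.to_isDomain S

end Domain

section Concrete

variable {k : Type u} [Field k] (a b c : k)

/-- The quotient map from the free algebra. -/
def Sklyanin.mk : FreeAlgebra k (Fin 3) →ₐ[k] Sklyanin k a b c :=
  RingQuot.mkAlgHom k (SklyaninRel k a b c)

theorem Sklyanin.isSklyanin :
    IsSklyanin a b c fun i => Sklyanin.mk a b c (FreeAlgebra.ι k i) where
  triple := by
    have h := fun {x y} (h : SklyaninRel k a b c x y) => RingQuot.mkAlgHom_rel k h
    have h1 := h .r1
    have h2 := h .r2
    have h3 := h .r3
    change Sklyanin.mk a b c _ = Sklyanin.mk a b c _ at h1 h2 h3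
    simp only [map_add, map_smul, map_mul, map_zero] at h1 h2 h3
    exact ⟨h1, h2, h3⟩
  adjoin := by
    have hs : Function.Surjective (Sklyanin.mk a b c) := RingQuot.mkAlgHom_surjective k _
    rw [show (fun i => Sklyanin.mk a b c (FreeAlgebra.ι k i))
      = Sklyanin.mk a b c ∘ FreeAlgebra.ι k from rfl, Set.range_comp, ← AlgHom.map_adjoin,
      FreeAlgebra.adjoin_range_ι, Algebra.map_top]
    exact (AlgHom.range_eq_top _).2 hs
  lift w hw := by
    refine ⟨RingQuot.liftAlgHom k ⟨FreeAlgebra.lift k w, fun {x y} h => ?_⟩, fun i => ?_⟩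
    · cases h <;>
        simp only [map_add, map_smul, map_mul, map_zero, FreeAlgebra.lift_ι_apply, hw.r1, hw.r2,
            hw.r3]
    · exact (RingQuot.liftAlgHom_mkAlgHom_apply _ _ _ _).trans (FreeAlgebra.lift_ι_apply _ _)

end Concrete

/-- The 3-dimensional Sklyanin algebra `S(a,b,c)` is a left and right Noetherian
integral domain. -/
theorem sklyanin_noetherian_domain
    (k : Type*) [Field k] [IsAlgClosed k] [CharZero k]
    (a b c : k) (habc : a * b * c ≠ 0)
    (hdeg : (3 * a * b * c) ^ 3 ≠ (a ^ 3 + b ^ 3 + c ^ 3) ^ 3) :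
    IsNoetherianRing (Sklyanin k a b c) ∧
    IsNoetherianRing (Sklyanin k a b c)ᵐᵒᵖ ∧
    IsDomain (Sklyanin k a b c) := by
  have h := Sklyanin.isSklyanin a b c
  refine ⟨h.isNoetherianRing habc hdeg, h.opposite.isNoetherianRing (by rwa [mul_comm b a]) ?_,
    h.isDomain habc hdeg⟩
  rwa [mul_right_comm 3 b a, add_comm (b ^ 3)]

end
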